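/- Let q ≥ 3 be a prime power, I an index set, η ∈ F_{q^2} with η^{q+1} = 1, and let 𝒫 be a set of q+1 triples in I × U × U. Define L_𝒫 := ⋃_{(α,u,v) ∈ 𝒫} ( p(P_{αu}, π_{αv}) \ {r_{U_1}} ) and Π_𝒫 := { (S_ℓ \ R_ℓ) ∪ R_ℓ^o : ℓ ∈ L_𝒫 } ∪ { D_η }. Then Π_𝒫 is a parallelism of Σ_η if and only if 𝒫 is a good set. -/

import Mathlib

open Projectivization Classical

noncomputable section

abbrev Pt (F : Type) [Field F] := Projectivization F (Fin 4 → F)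

variable (q : ℕ) (F : Type) [Field F]

/-- The line `t₁ = {(x₁, x₂, 0, 0)}` of `PG(3, q²)`. -/
def t1 : Set (Pt F) := {P | P.rep 2 = 0 ∧ P.rep 3 = 0}

/-- The line `t₂ = {(0, 0, x₃, x₄)}` of `PG(3, q²)`. -/
def t2 : Set (Pt F) := {P | P.rep 0 = 0 ∧ P.rep 1 = 0}

/-- The line `r_{U₁} = {(x₁, 0, x₃, 0)}` of `PG(3, q²)`. -/
def rU1 : Set (Pt F) := {P | P.rep 1 = 0 ∧ P.rep 3 = 0}

/-- The Baer subgeometry `Σ_α = {(x, y, α xᑫ, α yᑫ)}`. -/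
def SigmaSet (α : F) : Set (Pt F) :=
  {P | ∃ (x y : F) (h : ![x, y, α * x ^ q, α * y ^ q] ≠ 0),
    P = Projectivization.mk F ![x, y, α * x ^ q, α * y ^ q] h}

def tauFun (α : F) (v : Fin 4 → F) : Fin 4 → F :=
  ![(v 2) ^ q, (v 3) ^ q, α ^ (q + 1) * (v 0) ^ q, α ^ (q + 1) * (v 1) ^ q]

/-- The collineation `τ_α : (x₁,x₂,x₃,x₄) ↦ (x₃ᑫ, x₄ᑫ, α^{q+1} x₁ᑫ, α^{q+1} x₂ᑫ)`. -/
def tau (α : F) (P : Pt F) : Pt F :=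
  if h : tauFun q F α P.rep ≠ 0 then Projectivization.mk F _ h else P

/-- `s` is (the point set of) a line of `PG(3, q²)`. -/
def isLine (s : Set (Pt F)) : Prop :=
  ∃ W : Submodule F (Fin 4 → F), Module.finrank F W = 2 ∧
    s = {P : Pt F | P.submodule ≤ W}

/-- `s` is (the point set of) a plane of `PG(3, q²)`. -/
def isPlane (s : Set (Pt F)) : Prop :=
  ∃ W : Submodule F (Fin 4 → F), Module.finrank F W = 3 ∧
    s = {P : Pt F | P.submodule ≤ W}

/-- The set of points of the line (or point) spanned by `A` and `B`. -/
def lineThrough (A B : Pt F) : Set (Pt F) :=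
  {P : Pt F | P.submodule ≤ A.submodule ⊔ B.submodule}

/-- For `P = (a, b, 0, 0) ∈ t₁`, `rLine P` is the line through `(a,b,0,0)` and `(0,0,aᑫ,bᑫ)`. -/
def rLine (P : Pt F) : Set (Pt F) := lineThrough F P (tau q F 1 P)

/-- The Desarguesian line-spread `D_α = { r_P ∩ Σ_α : P ∈ t₁ }`. -/
def Dspread (α : F) : Set (Set (Pt F)) :=
  {s | ∃ P ∈ t1 F, s = rLine q F P ∩ SigmaSet q F α}

/-- `U = { u : u^{q+1} = 1 }`. -/
def Uset : Set F := {u : F | u ^ (q + 1) = 1}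

/-- The subfield `F_q` of `F_{q²}`, as a set. -/
def FqSet : Set F := {x : F | x ^ q = x}

/-- The norm image `N = { α^{q+1} : α ∈ I }`. -/
def normIm (I : Set F) : Set F := (fun α : F => α ^ (q + 1)) '' I

/-- `I` is an index set. -/
def IsIndexSet (I : Set F) : Prop :=
  (0 : F) ∉ I ∧
  Set.InjOn (fun α : F => α ^ (q + 1)) I ∧
  (∀ a ∈ normIm q F I, a ∈ FqSet q F) ∧
  (1 : F) ∉ normIm q F I ∧
  normIm q F I ∪ Inv.inv '' normIm q F I ∪ {1} = FqSet q F \ {0} ∧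
  (Even q → normIm q F I ∩ Inv.inv '' normIm q F I = ∅) ∧
  (Odd q → normIm q F I ∩ Inv.inv '' normIm q F I = {-1} ∧
    normIm q F I ∩ Neg.neg '' normIm q F I = ∅)

lemma vec4_ne_zero_fst (a b c d : F) (ha : a ≠ 0) : ![a, b, c, d] ≠ 0 := by
  intro h
  exact ha (by simpa using congrFun h 0)

/-- The point `P_{αu} = (1, 0, αu, 0)`. -/
def Ppt (α u : F) : Pt F :=
  Projectivization.mk F ![1, 0, α * u, 0] (vec4_ne_zero_fst F 1 0 (α * u) 0 one_ne_zero)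

/-- The plane `π_{αv} : X₄ = α v X₂`. -/
def planeSet (α v : F) : Set (Pt F) := {P | P.rep 3 = α * v * P.rep 1}

/-- The Baer subpencil `p(P_{αu}, π_{αv})`: the lines through `P_{αu}` contained in `π_{αv}`
meeting `Σ_α` in `q+1` points. -/
def pencil (α u v : F) : Set (Set (Pt F)) :=
  {ℓ | isLine F ℓ ∧ Ppt F α u ∈ ℓ ∧ ℓ ⊆ planeSet F α v ∧ (ℓ ∩ SigmaSet q F α).ncard = q + 1}

/-- `m` is a line of the Baer subgeometry `Σ_η`. -/
def IsLineOfSigma (η : F) (m : Set (Pt F)) : Prop :=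
  ∃ s : Set (Pt F), isLine F s ∧ m = s ∩ SigmaSet q F η ∧ m.ncard = q + 1

/-- `S` is a line-spread of `Σ_η`. -/
def IsSpreadOfSigma (η : F) (S : Set (Set (Pt F))) : Prop :=
  (∀ m ∈ S, IsLineOfSigma q F η m) ∧
  (∀ m ∈ S, ∀ m' ∈ S, m ≠ m' → m ∩ m' = ∅) ∧
  ⋃₀ S = SigmaSet q F η

/-- `Pl` is a parallelism of `Σ_η`. -/
def IsParallelismOfSigma (η : F) (Pl : Set (Set (Set (Pt F)))) : Prop :=
  (∀ S ∈ Pl, IsSpreadOfSigma q F η S) ∧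
  ∀ m : Set (Pt F), IsLineOfSigma q F η m → ∃! S, S ∈ Pl ∧ m ∈ S

/-- `R` is a regulus of `Σ_η`. -/
def IsRegulusOfSigma (η : F) (R : Set (Set (Pt F))) : Prop :=
  ∃ m1 m2 m3 : Set (Pt F),
    IsLineOfSigma q F η m1 ∧ IsLineOfSigma q F η m2 ∧ IsLineOfSigma q F η m3 ∧
    m1 ∩ m2 = ∅ ∧ m1 ∩ m3 = ∅ ∧ m2 ∩ m3 = ∅ ∧
    R = {m | IsLineOfSigma q F η m ∧
      (m ∩ m1).Nonempty ∧ (m ∩ m2).Nonempty ∧ (m ∩ m3).Nonempty}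

/-- `S_ℓ = { ⟨Q, τ_η(Q)⟩ ∩ Σ_η : Q ∈ ℓ }`. -/
def Sspread (η : F) (ℓ : Set (Pt F)) : Set (Set (Pt F)) :=
  {m | ∃ Q ∈ ℓ, m = lineThrough F Q (tau q F η Q) ∩ SigmaSet q F η}

/-- `R_ℓ = D_η ∩ S_ℓ`. -/
def Rreg (η : F) (ℓ : Set (Pt F)) : Set (Set (Pt F)) :=
  Dspread q F η ∩ Sspread q F η ℓ

/-- `R_ℓᵒ`: the set of lines of `Σ_η` meeting every line of `R_ℓ`. -/
def Ropp (η : F) (ℓ : Set (Pt F)) : Set (Set (Pt F)) :=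
  {m | IsLineOfSigma q F η m ∧ ∀ m' ∈ Rreg q F η ℓ, (m ∩ m').Nonempty}

/-- `G` is a good set (relative to the index set `I`). -/
def IsGoodSet (I : Set F) (G : Finset (F × F × F)) : Prop :=
  G.card = q + 1 ∧
  (∀ t ∈ G, t.1 ∈ I ∧ t.2.1 ∈ Uset q F ∧ t.2.2 ∈ Uset q F) ∧
  ∀ t ∈ G, ∀ t' ∈ G, t ≠ t' →
    t.2.1 * t'.2.2 - t'.2.1 * t.2.2 ≠ 0 ∧
    t.1 * t.2.1 * (t'.1 * t'.2.2) ^ q - (t.1 * t.2.2) ^ q * (t'.1 * t'.2.1) ≠ 0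

/-- `L_G = ⋃_{(α,u,v) ∈ G} ( p(P_{αu}, π_{αv}) \ {r_{U₁}} )`. -/
def Lset (G : Finset (F × F × F)) : Set (Set (Pt F)) :=
  ⋃ t ∈ G, (pencil q F t.1 t.2.1 t.2.2 \ {rU1 F})

/-- The putative parallelism `Π_G` associated with `G`. -/
def ParP (η : F) (G : Finset (F × F × F)) : Set (Set (Set (Pt F))) :=
  {S | ∃ ℓ ∈ Lset q F G, S = (Sspread q F η ℓ \ Rreg q F η ℓ) ∪ Ropp q F η ℓ}
    ∪ {Dspread q F η}

def gFun (b : F) (v : Fin 4 → F) : Fin 4 → F :=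
  ![v 0 + b * v 1, v 1, v 2 + b ^ q * v 3, v 3]

/-- The projectivity `g_b : (x₁,x₂,x₃,x₄) ↦ (x₁ + b x₂, x₂, x₃ + bᑫ x₄, x₄)`. -/
def gmap (b : F) (P : Pt F) : Pt F :=
  if h : gFun q F b P.rep ≠ 0 then Projectivization.mk F _ h else P

end

section Algebra

variable {F : Type} [Field F] (σ : F →+* F)

/-- The subfield of elements fixed by `σ`. -/
abbrev fixedField : Subfield F := σ.eqLocusField (RingHom.id F)

/-- `σ` is the nontrivial automorphism of a quadratic extension. -/
structure IsQuadConj : Prop where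
  involutive : ∀ x, σ (σ x) = x
  ne : ∃ y, σ y ≠ y
  finrank : Module.finrank (fixedField σ) F = 2

variable {σ}

lemma mem_fixedField {x : F} : x ∈ fixedField σ ↔ σ x = x := Iff.rfl

lemma fixedField.coe_eq (c : fixedField σ) : σ c = c := c.2

lemma IsQuadConj.exists_trace_one (h : IsQuadConj σ) : ∃ c : F, c + σ c = 1 := by
  obtain ⟨y, hy⟩ := h.ne
  have h1 : y - σ y ≠ 0 := fun h0 => hy (sub_eq_zero.1 h0).symm
  have h2 : σ y - y ≠ 0 := fun h0 => hy (sub_eq_zero.1 h0)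
  refine ⟨y / (y - σ y), ?_⟩
  simp only [map_div₀, map_sub, h.involutive]
  grind

/-- The additive form of Hilbert 90. -/
lemma IsQuadConj.exists_sub_eq (h : IsQuadConj σ) {d : F} (hd : σ d = -d) :
    ∃ z, σ z - z = d := by
  obtain ⟨c, hc⟩ := h.exists_trace_one
  refine ⟨-(c * d), ?_⟩
  simp only [map_neg, map_mul, hd]
  linear_combination d * hc

/-- The multiplicative form of Hilbert 90. -/
lemma IsQuadConj.exists_eq_mul (h : IsQuadConj σ) {u : F} (hu : u * σ u = 1) :
    ∃ z, z ≠ 0 ∧ σ z = u * z := by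
  obtain ⟨y, hy⟩ := h.ne
  by_cases h1 : u = -1
  · refine ⟨y - σ y, fun h0 => hy (sub_eq_zero.1 h0).symm, ?_⟩
    simp only [map_sub, h.involutive, h1]; ring
  · refine ⟨1 + σ u, fun h0 => h1 ?_, ?_⟩
    · linear_combination u * h0 - hu
    · simp only [map_add, map_one, h.involutive]
      linear_combination -hu

variable (σ)

/-- The map `z ↦ a z + b σ(z)`. -/
def twist (a b : F) : F →ₗ[fixedField σ] F where
  toFun z := a * z + b * σ z
  map_add' x y := by simp only [map_add]; ring
  map_smul' c x := by
    simp only [Subfield.smul_def, smul_eq_mul, map_mul, RingHom.id_apply, fixedField.coe_eq]; ring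

@[simp] lemma twist_apply (a b z : F) : twist σ a b z = a * z + b * σ z := rfl

/-- The one-dimensional `F`-subspace spanned by `w`, over the fixed field. -/
def fieldLine (w : F × F) : Submodule (fixedField σ) (F × F) :=
  LinearMap.range ((twist σ w.1 0).prod (twist σ w.2 0))

/-- The graph of `z ↦ a z + b σ(z)`. -/
def graphLine (a b : F) : Submodule (fixedField σ) (F × F) :=
  LinearMap.range ((twist σ a b).prod (twist σ 1 0))

/-- The multiple by `c` of the standard subplane. -/
def subLine (c : F) : Submodule (fixedField σ) (F × F) :=
  LinearMap.range ((LinearMap.toSpanSingleton (fixedField σ) F c).prodMap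
    (LinearMap.toSpanSingleton (fixedField σ) F c))

variable {σ}

lemma mem_fieldLine {w x : F × F} : x ∈ fieldLine σ w ↔ ∃ l : F, x = (l * w.1, l * w.2) := by
  simp only [fieldLine, LinearMap.mem_range, LinearMap.prod_apply, Function.prod_apply, twist_apply]
  exact exists_congr fun l => by simp [eq_comm, mul_comm]

lemma mem_graphLine {a b : F} {x : F × F} :
    x ∈ graphLine σ a b ↔ x.1 = a * x.2 + b * σ x.2 := by
  simp only [graphLine, LinearMap.mem_range, LinearMap.prod_apply, Function.prod_apply, twist_apply]
  constructor
  · rintro ⟨l, rfl⟩; simp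
  · intro h; exact ⟨x.2, Prod.ext (by simp [h]) (by simp)⟩

lemma mem_subLine {c : F} {x : F × F} :
    x ∈ subLine σ c ↔ ∃ a b : F, σ a = a ∧ σ b = b ∧ x = (c * a, c * b) := by
  simp only [subLine, LinearMap.mem_range, LinearMap.prodMap_apply,
    LinearMap.toSpanSingleton_apply, Subfield.smul_def, smul_eq_mul]
  constructor
  · rintro ⟨⟨a, b⟩, rfl⟩; exact ⟨a, b, a.2, b.2, by simp [mul_comm]⟩
  · rintro ⟨a, b, ha, hb, rfl⟩
    exact ⟨(⟨a, ha⟩, ⟨b, hb⟩), by simp [mul_comm]⟩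

lemma IsQuadConj.finrank_range (h : IsQuadConj σ) {f : F →ₗ[fixedField σ] F × F}
    (hf : Function.Injective f) :
    Module.finrank (fixedField σ) (LinearMap.range f) = 2 := by
  rw [LinearMap.finrank_range_of_inj hf, h.finrank]

lemma IsQuadConj.finrank_fieldLine (h : IsQuadConj σ) {w : F × F} (hw : w ≠ 0) :
    Module.finrank (fixedField σ) (fieldLine σ w) = 2 := by
  refine h.finrank_range ((injective_iff_map_eq_zero _).2 fun l hl => ?_)
  simp only [LinearMap.prod_apply, Function.prod_apply, twist_apply, zero_mul, add_zero,
    Prod.mk_eq_zero, mul_eq_zero] at hl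
  by_contra h0
  exact hw (Prod.ext (hl.1.resolve_right h0) (hl.2.resolve_right h0))

lemma IsQuadConj.finrank_graphLine (h : IsQuadConj σ) (a b : F) :
    Module.finrank (fixedField σ) (graphLine σ a b) = 2 := by
  refine h.finrank_range ((injective_iff_map_eq_zero _).2 fun l hl => ?_)
  simpa using congrArg Prod.snd hl

lemma finrank_subLine {c : F} (hc : c ≠ 0) :
    Module.finrank (fixedField σ) (subLine σ c) = 2 := by
  rw [subLine, LinearMap.finrank_range_of_inj]
  · simp
  · refine (injective_iff_map_eq_zero _).2 fun x hx => ?_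
    simp only [LinearMap.prodMap_apply, LinearMap.toSpanSingleton_apply, Subfield.smul_def,
      smul_eq_mul, Prod.mk_eq_zero, mul_eq_zero, hc, or_false] at hx
    exact Prod.ext (Subtype.ext hx.1) (Subtype.ext hx.2)

end Algebra

section Spreads

variable {F : Type} [Field F] {σ : F →+* F}

/-- A two-dimensional space is spanned by any two independent vectors in it. -/
lemma exists_combination_of_finrank_eq_two {k V : Type*} [Field k] [AddCommGroup V] [Module k V]
    {M : Submodule k V} (hM : Module.finrank k M = 2) {v w : V} (hv : v ∈ M) (hw : w ∈ M)
    (hvw : LinearIndependent k ![v, w]) {x : V} (hx : x ∈ M) : ∃ a b : k, a • v + b • w = x := by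
  have hle : Submodule.span k {v, w} ≤ M := by
    rw [Submodule.span_le]; rintro y (rfl | rfl) <;> assumption
  have : Module.Finite k M := Module.finite_of_finrank_pos (by omega)
  have h2 : Module.finrank k (Submodule.span k {v, w}) = 2 := by
    have := finrank_span_eq_card hvw
    rwa [Matrix.range_cons_cons_empty, Fintype.card_fin] at this
  rw [← Submodule.eq_of_le_of_finrank_eq hle (h2.trans hM.symm), Submodule.mem_span_pair] at hx
  exact hx

lemma eq_of_le_of_finrank_eq_two {k V : Type*} [Field k] [AddCommGroup V] [Module k V]
    {M N : Submodule k V} (hle : M ≤ N) (hM : Module.finrank k M = 2)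
    (hN : Module.finrank k N = 2) : M = N := by
  have : Module.Finite k N := Module.finite_of_finrank_pos (by omega)
  exact Submodule.eq_of_le_of_finrank_eq hle (hM.trans hN.symm)

lemma finrank_map_of_injective {k V : Type*} [Field k] [AddCommGroup V] [Module k V]
    {f : V →ₗ[k] V} (hf : Function.Injective f) {M : Submodule k V} :
    Module.finrank k (M.map f) = Module.finrank k M :=
  (Submodule.equivMapOfInjective f hf M).finrank_eq.symm

/-- A partition of the nonzero vectors into two-dimensional subspaces. -/
def IsVectorSpread {k V : Type*} [Field k] [AddCommGroup V] [Module k V]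
    (S : Set (Submodule k V)) : Prop :=
  (∀ M ∈ S, Module.finrank k M = 2) ∧ ∀ w : V, w ≠ 0 → ∃! M, M ∈ S ∧ w ∈ M

lemma IsVectorSpread.map {k V : Type*} [Field k] [AddCommGroup V] [Module k V]
    {S : Set (Submodule k V)} (hS : IsVectorSpread S) {f : V →ₗ[k] V}
    (hf : Function.Bijective f) : IsVectorSpread (Submodule.map f '' S) := by
  constructor
  · rintro _ ⟨M, hM, rfl⟩
    rw [finrank_map_of_injective hf.1, hS.1 M hM]
  · intro w hw
    obtain ⟨v, rfl⟩ := hf.2 w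
    obtain ⟨M, hM, huniq⟩ := hS.2 v (by rintro rfl; simp at hw)
    refine ⟨M.map f, ⟨⟨M, hM.1, rfl⟩, Submodule.mem_map_of_mem hM.2⟩, ?_⟩
    rintro _ ⟨⟨N, hN, rfl⟩, hvN⟩
    rw [huniq N ⟨hN, by simpa [Submodule.mem_map, hf.1.eq_iff] using hvN⟩]

variable (σ)

/-- The Desarguesian spread. -/
def desSpread : Set (Submodule (fixedField σ) (F × F)) :=
  {M | ∃ w ≠ 0, M = fieldLine σ w}

/-- The map `z ↦ z + k σ(z)` on both coordinates. -/
def twistPair (k : F) : F × F →ₗ[fixedField σ] F × F := (twist σ 1 k).prodMap (twist σ 1 k)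

/-- The image of the Desarguesian spread under `twistPair`. -/
def twistSpread (k : F) : Set (Submodule (fixedField σ) (F × F)) :=
  Submodule.map (twistPair σ k) '' desSpread σ

/-- The two-dimensional subspaces meeting every member of `R` nontrivially. -/
def transversals (R : Set (Submodule (fixedField σ) (F × F))) :
    Set (Submodule (fixedField σ) (F × F)) :=
  {M | Module.finrank (fixedField σ) M = 2 ∧ ∀ N ∈ R, ∃ w ≠ 0, w ∈ M ∧ w ∈ N}

/-- The spread obtained from `twistSpread` by switching its regulus in the Desarguesian spread. -/
def switchedSpread (k : F) : Set (Submodule (fixedField σ) (F × F)) :=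
  (twistSpread σ k \ (desSpread σ ∩ twistSpread σ k)) ∪
    transversals σ (desSpread σ ∩ twistSpread σ k)

variable {σ}

lemma fieldLine_smul {c : F} (hc : c ≠ 0) (w : F × F) : fieldLine σ (c • w) = fieldLine σ w := by
  ext x
  simp only [mem_fieldLine, Prod.smul_fst, Prod.smul_snd, smul_eq_mul]
  constructor
  · rintro ⟨l, rfl⟩; exact ⟨l * c, by simp [mul_assoc]⟩
  · rintro ⟨l, rfl⟩; exact ⟨l / c, by simp [div_mul_eq_mul_div, mul_div_assoc, hc]⟩

lemma self_mem_fieldLine (w : F × F) : w ∈ fieldLine σ w := mem_fieldLine.2 ⟨1, by simp⟩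

lemma fieldLine_eq_of_mem {w x : F × F} (hx : x ∈ fieldLine σ w) (h0 : x ≠ 0) :
    fieldLine σ w = fieldLine σ x := by
  obtain ⟨l, rfl⟩ := mem_fieldLine.1 hx
  have hl : l ≠ 0 := by rintro rfl; simp at h0
  exact (fieldLine_smul hl w).symm

lemma IsQuadConj.isVectorSpread_desSpread (h : IsQuadConj σ) :
    IsVectorSpread (desSpread σ) := by
  constructor
  · rintro _ ⟨w, hw, rfl⟩; exact h.finrank_fieldLine hw
  · intro w hw
    refine ⟨fieldLine σ w, ⟨⟨w, hw, rfl⟩, self_mem_fieldLine w⟩, ?_⟩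
    rintro _ ⟨⟨x, -, rfl⟩, hwx⟩
    exact fieldLine_eq_of_mem hwx hw

section Twist

variable {k : F}

lemma twist_bijective (h : IsQuadConj σ) (hk : k * σ k ≠ 1) :
    Function.Bijective (twist σ 1 k) := by
  have h1 : 1 - k * σ k ≠ 0 := fun h0 => hk (sub_eq_zero.1 h0).symm
  constructor
  · refine (injective_iff_map_eq_zero _).2 fun z hz => ?_
    simp only [twist_apply, one_mul] at hz
    have hz' := congrArg σ hz
    simp only [map_add, map_mul, h.involutive, map_zero] at hz'
    have : z * (1 - k * σ k) = 0 := by linear_combination hz - k * hz'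
    exact (mul_eq_zero.1 this).resolve_right h1
  · intro z
    have h2 : 1 - σ k * k ≠ 0 := by rwa [mul_comm (σ k)]
    refine ⟨(z - k * σ z) / (1 - k * σ k), ?_⟩
    simp only [twist_apply, map_div₀, map_sub, map_mul, h.involutive, map_one]
    field_simp
    ring

lemma twistPair_apply (w : F × F) :
    twistPair σ k w = (w.1 + k * σ w.1, w.2 + k * σ w.2) := by simp [twistPair]

lemma twistPair_bijective (h : IsQuadConj σ) (hk : k * σ k ≠ 1) :
    Function.Bijective (twistPair σ k) :=
  (twist_bijective h hk).prodMap (twist_bijective h hk)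

lemma isVectorSpread_twistSpread (h : IsQuadConj σ) (hk : k * σ k ≠ 1) :
    IsVectorSpread (twistSpread σ k) :=
  h.isVectorSpread_desSpread.map (twistPair_bijective h hk)

lemma mem_map_twistPair_fieldLine {w x : F × F} :
    x ∈ (fieldLine σ w).map (twistPair σ k) ↔
      ∃ l : F, x = (l * w.1 + k * σ (l * w.1), l * w.2 + k * σ (l * w.2)) := by
  simp only [Submodule.mem_map, mem_fieldLine]
  constructor
  · rintro ⟨_, ⟨l, rfl⟩, rfl⟩; exact ⟨l, twistPair_apply _⟩
  · rintro ⟨l, rfl⟩; exact ⟨_, ⟨l, rfl⟩, twistPair_apply _⟩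

lemma map_twistPair_fieldLine_fixed (h : IsQuadConj σ) (hk : k * σ k ≠ 1) {w : F × F}
    (h1 : σ w.1 = w.1) (h2 : σ w.2 = w.2) :
    (fieldLine σ w).map (twistPair σ k) = fieldLine σ w := by
  ext x
  rw [mem_map_twistPair_fieldLine, mem_fieldLine]
  constructor
  · rintro ⟨l, rfl⟩
    exact ⟨l + k * σ l, by simp only [map_mul, h1, h2]; ext <;> ring⟩
  · rintro ⟨l, rfl⟩
    obtain ⟨m, hm⟩ := (twist_bijective h hk).2 l
    refine ⟨m, ?_⟩
    simp only [twist_apply, one_mul] at hm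
    simp only [map_mul, h1, h2, ← hm]
    ext <;> ring

/-- A twisted field line `⟨(s, 1)⟩` is the graph of `z ↦ a z + b σ(z)` for explicit `a`, `b`. -/
lemma map_twistPair_fieldLine_eq_graphLine_iff (h : IsQuadConj σ) (hk : k * σ k ≠ 1)
    {s a b : F} : (fieldLine σ (s, 1)).map (twistPair σ k) = graphLine σ a b ↔
      s = a + b * σ k ∧ k * σ s = a * k + b := by
  constructor
  · intro he
    have key : ∀ l, l * s + k * σ (l * s) = a * (l + k * σ l) + b * σ (l + k * σ l) := by
      intro l
      have : (l * s + k * σ (l * s), l * 1 + k * σ (l * 1)) ∈ graphLine σ a b := by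
        rw [← he]; exact mem_map_twistPair_fieldLine.2 ⟨l, rfl⟩
      simpa [mem_graphLine] using this
    obtain ⟨y, hy⟩ := h.ne
    have hy' : y - σ y ≠ 0 := fun h0 => hy (sub_eq_zero.1 h0).symm
    have e1 := key 1
    have e2 := key y
    simp only [map_mul, map_add, h.involutive, map_one, one_mul, mul_one] at e1 e2
    have : (y - σ y) * (s - (a + b * σ k)) = 0 := by linear_combination e2 - σ y * e1
    have hs := sub_eq_zero.1 ((mul_eq_zero.1 this).resolve_left hy')
    exact ⟨hs, by linear_combination e1 - hs⟩
  · rintro ⟨e1, e2⟩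
    refine eq_of_le_of_finrank_eq_two ?_ ?_ (h.finrank_graphLine a b)
    · intro x hx
      obtain ⟨l, rfl⟩ := mem_map_twistPair_fieldLine.1 hx
      simp only [mem_graphLine, map_mul, map_add, h.involutive, mul_one]
      linear_combination l * e1 + σ l * e2
    · rw [finrank_map_of_injective (twistPair_bijective h hk).1,
        h.finrank_fieldLine (by simp)]

lemma fieldLine_eq_graphLine (s : F) : fieldLine σ (s, 1) = graphLine σ s 0 := by
  ext x
  simp only [mem_fieldLine, mem_graphLine]
  constructor
  · rintro ⟨l, rfl⟩; simp [mul_comm]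
  · intro hx; exact ⟨x.2, Prod.ext (by simp [hx, mul_comm]) (by simp)⟩

lemma graphLine_injective (h : IsQuadConj σ) {a b a' b' : F}
    (he : graphLine σ a b = graphLine σ a' b') : a = a' ∧ b = b' := by
  have key : ∀ l, a * l + b * σ l = a' * l + b' * σ l := by
    intro l
    have : (a * l + b * σ l, l) ∈ graphLine σ a' b' := by rw [← he, mem_graphLine]
    simpa [mem_graphLine] using this
  obtain ⟨y, hy⟩ := h.ne
  have hy' : y - σ y ≠ 0 := fun h0 => hy (sub_eq_zero.1 h0).symm
  have e1 := key 1
  have e2 := key y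
  simp only [map_one, mul_one] at e1
  have : (y - σ y) * (a - a') = 0 := by linear_combination e2 - σ y * e1
  have ha := sub_eq_zero.1 ((mul_eq_zero.1 this).resolve_left hy')
  exact ⟨ha, by linear_combination e1 - ha⟩

/-- Up to scaling, a nonzero vector is `(1, 0)` or of the form `(s, 1)`. -/
lemma exists_fieldLine_normal_form {w : F × F} (hw : w ≠ 0) :
    fieldLine σ w = fieldLine σ (1, 0) ∨ ∃ s, fieldLine σ w = fieldLine σ (s, 1) := by
  by_cases h2 : w.2 = 0
  · have h1 : w.1 ≠ 0 := fun h1 => hw (Prod.ext h1 h2)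
    refine Or.inl ?_
    rw [← fieldLine_smul h1 (1, 0)]
    congr 1; ext <;> simp [h2]
  · refine Or.inr ⟨w.1 / w.2, ?_⟩
    rw [← fieldLine_smul h2 (w.1 / w.2, 1)]
    congr 1; ext <;> simp; field_simp

/-- The common members of the Desarguesian spread and its twist form the standard regulus. -/
lemma mem_desSpread_inter_twistSpread (h : IsQuadConj σ) (hk : k * σ k ≠ 1) (hk0 : k ≠ 0)
    {M : Submodule (fixedField σ) (F × F)} :
    M ∈ desSpread σ ∩ twistSpread σ k ↔
      ∃ w ≠ 0, σ w.1 = w.1 ∧ σ w.2 = w.2 ∧ M = fieldLine σ w := by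
  constructor
  · rintro ⟨⟨w, hw, rfl⟩, ⟨_, ⟨x, hx, rfl⟩, he⟩⟩
    rcases exists_fieldLine_normal_form (σ := σ) hx with h' | ⟨s, h'⟩ <;> rw [h'] at he
    · rw [map_twistPair_fieldLine_fixed h hk (by simp) (by simp)] at he
      exact ⟨(1, 0), by simp, by simp, by simp, he.symm⟩
    · rcases exists_fieldLine_normal_form (σ := σ) hw with h'' | ⟨r, h''⟩
      · exact ⟨(1, 0), by simp, by simp, by simp, h''⟩
      · rw [h'', fieldLine_eq_graphLine r, map_twistPair_fieldLine_eq_graphLine_iff h hk] at he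
        refine ⟨(r, 1), by simp, ?_, by simp, h''⟩
        obtain ⟨e1, e2⟩ := he
        obtain rfl : s = r := by simpa using e1
        exact mul_left_cancel₀ hk0 (by linear_combination e2)
  · rintro ⟨w, hw, h1, h2, rfl⟩
    exact ⟨⟨w, hw, rfl⟩, ⟨_, ⟨w, hw, rfl⟩, map_twistPair_fieldLine_fixed h hk h1 h2⟩⟩

/-- The opposite regulus consists of the multiples of the standard subplane. -/
lemma mem_transversals (h : IsQuadConj σ) (hk : k * σ k ≠ 1) (hk0 : k ≠ 0)
    {M : Submodule (fixedField σ) (F × F)} :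
    M ∈ transversals σ (desSpread σ ∩ twistSpread σ k) ↔ ∃ c ≠ 0, M = subLine σ c := by
  constructor
  · rintro ⟨hM, hR⟩
    have hR' : ∀ w : F × F, w ≠ 0 → σ w.1 = w.1 → σ w.2 = w.2 →
        ∃ l : F, l ≠ 0 ∧ (l * w.1, l * w.2) ∈ M := by
      intro w hw h1 h2
      obtain ⟨x, hx, hxM, hxw⟩ := hR _ ((mem_desSpread_inter_twistSpread h hk hk0).2
        ⟨w, hw, h1, h2, rfl⟩)
      obtain ⟨l, rfl⟩ := mem_fieldLine.1 hxw
      exact ⟨l, by rintro rfl; simp at hx, hxM⟩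
    obtain ⟨p, hp, hpM⟩ := hR' (1, 0) (by simp) (by simp) (by simp)
    obtain ⟨r, hr, hrM⟩ := hR' (0, 1) (by simp) (by simp) (by simp)
    obtain ⟨z, hz, hzM⟩ := hR' (1, 1) (by simp) (by simp) (by simp)
    simp only [mul_one, mul_zero] at hpM hrM hzM
    have hind : LinearIndependent (fixedField σ) ![((p, 0) : F × F), (0, r)] := by
      rw [LinearIndependent.pair_iff]
      intro a b hab
      simpa [Subfield.smul_def, hp, hr] using hab
    obtain ⟨a, b, hab⟩ := exists_combination_of_finrank_eq_two hM hpM hrM hind hzM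
    have ha : (z, 0) ∈ M := by
      have : ((z, 0) : F × F) = a • (p, 0) := by simpa using congrArg Prod.fst hab.symm
      rw [this]; exact M.smul_mem _ hpM
    have hb : (0, z) ∈ M := by
      have : ((0, z) : F × F) = b • (0, r) := by simpa using congrArg Prod.snd hab.symm
      rw [this]; exact M.smul_mem _ hrM
    have hle : subLine σ z ≤ M := by
      intro x hx
      obtain ⟨a, b, h1, h2, hx⟩ := mem_subLine.1 hx
      have : x = (⟨a, h1⟩ : fixedField σ) • ((z, 0) : F × F) +
          (⟨b, h2⟩ : fixedField σ) • ((0, z) : F × F) := by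
        rw [hx]; ext <;> simp [Subfield.smul_def, mul_comm]
      rw [this]
      exact M.add_mem (M.smul_mem _ ha) (M.smul_mem _ hb)
    exact ⟨z, hz, (eq_of_le_of_finrank_eq_two hle (finrank_subLine hz) hM).symm⟩
  · rintro ⟨c, hc, rfl⟩
    refine ⟨finrank_subLine hc, fun N hN => ?_⟩
    obtain ⟨w, hw, h1, h2, rfl⟩ := (mem_desSpread_inter_twistSpread h hk hk0).1 hN
    exact ⟨c • w, smul_ne_zero hc hw, mem_subLine.2 ⟨_, _, h1, h2, rfl⟩,
      mem_fieldLine.2 ⟨c, rfl⟩⟩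

lemma subLine_smul {c d : F} (hc : c ≠ 0) (hc' : σ c = c) : subLine σ (c * d) = subLine σ d := by
  ext x
  simp only [mem_subLine]
  constructor
  · rintro ⟨a, b, ha, hb, rfl⟩
    exact ⟨c * a, c * b, by simp [hc', ha], by simp [hc', hb], by ext <;> simp <;> ring⟩
  · rintro ⟨a, b, ha, hb, rfl⟩
    exact ⟨a / c, b / c, by simp [hc', ha], by simp [hc', hb], by ext <;> simp <;> field_simp⟩

lemma subLine_eq_of_mem {c d : F} {w : F × F} (hw : w ≠ 0) (hc : w ∈ subLine σ c)
    (hd : w ∈ subLine σ d) : subLine σ c = subLine σ d := by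
  obtain ⟨a, b, ha, hb, rfl⟩ := mem_subLine.1 hc
  obtain ⟨a', b', ha', hb', he⟩ := mem_subLine.1 hd
  obtain ⟨e1, e2⟩ := Prod.mk.inj he
  have key : ∀ x y : F, σ x = x → σ y = y → c * x = d * y → c * x ≠ 0 →
      subLine σ c = subLine σ d := by
    intro x y hx hy hxy hx0
    have hc0 : c ≠ 0 := left_ne_zero_of_mul hx0
    have hx1 : x ≠ 0 := right_ne_zero_of_mul hx0
    have hy1 : y ≠ 0 := right_ne_zero_of_mul (hxy ▸ hx0)
    have : c = y / x * d := by field_simp; linear_combination hxy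
    rw [this, subLine_smul (div_ne_zero hy1 hx1) (by simp [hx, hy])]
  by_cases h1 : c * a = 0
  · by_cases h2 : c * b = 0
    · exact absurd (Prod.ext h1 h2) hw
    · exact key _ _ hb hb' e2 h2
  · exact key _ _ ha ha' e1 h1

theorem isVectorSpread_switchedSpread (h : IsQuadConj σ) (hk : k * σ k ≠ 1) (hk0 : k ≠ 0) :
    IsVectorSpread (switchedSpread σ k) := by
  have hS := isVectorSpread_twistSpread h hk
  constructor
  · rintro M (hM | hM)
    · exact hS.1 M hM.1
    · exact hM.1
  · intro w hw
    by_cases hR : fieldLine σ w ∈ desSpread σ ∩ twistSpread σ k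
    · obtain ⟨x, hx, h1, h2, he⟩ := (mem_desSpread_inter_twistSpread h hk hk0).1 hR
      obtain ⟨l, hl⟩ := mem_fieldLine.1 (he ▸ self_mem_fieldLine (σ := σ) w)
      have hl0 : l ≠ 0 := by rintro rfl; simp at hl; exact hw hl
      have hwl : w ∈ subLine σ l := mem_subLine.2 ⟨_, _, h1, h2, hl⟩
      refine ⟨subLine σ l, ⟨Or.inr ((mem_transversals h hk hk0).2 ⟨l, hl0, rfl⟩), hwl⟩, ?_⟩
      rintro N ⟨hN | hN, hwN⟩
      · exact absurd ((hS.2 w hw).unique ⟨hN.1, hwN⟩ ⟨hR.2, self_mem_fieldLine w⟩ ▸ hR) hN.2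
      · obtain ⟨c, -, rfl⟩ := (mem_transversals h hk hk0).1 hN
        exact subLine_eq_of_mem hw hwN hwl
    · obtain ⟨M, hM, huniq⟩ := hS.2 w hw
      refine ⟨M, ⟨Or.inl ⟨hM.1, fun hMR => hR ?_⟩, hM.2⟩, ?_⟩
      · obtain ⟨x, hx, rfl⟩ := hMR.1
        rwa [fieldLine_eq_of_mem hM.2 hw] at hMR
      · rintro N ⟨hN | hN, hwN⟩
        · exact huniq N ⟨hN.1, hwN⟩
        · obtain ⟨c, hc, rfl⟩ := (mem_transversals h hk hk0).1 hN
          obtain ⟨a, b, ha, hb, rfl⟩ := mem_subLine.1 hwN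
          refine absurd ((mem_desSpread_inter_twistSpread h hk hk0).2 ⟨(a, b), ?_, ha, hb, ?_⟩) hR
          · rintro h0
            obtain ⟨rfl, rfl⟩ := Prod.mk.inj h0
            simp at hw
          · exact fieldLine_smul hc (a, b)

end Twist

end Spreads

section Shear

variable {F : Type} [Field F] {σ : F →+* F}

variable (σ) in
/-- The `F`-linear map with matrix `!![a, b; 0, d]`. -/
def shear (a b d : F) : F × F →ₗ[fixedField σ] F × F where
  toFun w := (a * w.1 + b * w.2, d * w.2)
  map_add' v w := by ext <;> simp <;> ring
  map_smul' c w := by ext <;> simp [Subfield.smul_def] <;> ring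

@[simp] lemma shear_apply (a b d : F) (w : F × F) :
    shear σ a b d w = (a * w.1 + b * w.2, d * w.2) := rfl

lemma shear_bijective {a d : F} (ha : a ≠ 0) (hd : d ≠ 0) (b : F) :
    Function.Bijective (shear σ a b d) := by
  constructor
  · refine (injective_iff_map_eq_zero _).2 fun w hw => ?_
    obtain ⟨h1, h2⟩ := Prod.mk.inj hw
    have h2 := (mul_eq_zero.1 h2).resolve_left hd
    rw [h2, mul_zero, add_zero] at h1
    exact Prod.ext ((mul_eq_zero.1 h1).resolve_left ha) h2
  · intro w
    refine ⟨((w.1 - b * (w.2 / d)) / a, w.2 / d), ?_⟩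
    ext <;> simp <;> field_simp
    ring

lemma map_shear_injective {a d : F} (ha : a ≠ 0) (hd : d ≠ 0) (b : F) :
    Function.Injective (Submodule.map (shear σ a b d)) :=
  Submodule.map_injective_of_injective (shear_bijective ha hd b).1

lemma map_shear_fieldLine (a b d : F) (w : F × F) :
    (fieldLine σ w).map (shear σ a b d) = fieldLine σ (shear σ a b d w) := by
  ext x
  simp only [Submodule.mem_map, mem_fieldLine]
  constructor
  · rintro ⟨_, ⟨l, rfl⟩, rfl⟩; exact ⟨l, by ext <;> simp <;> ring⟩
  · rintro ⟨l, rfl⟩; exact ⟨_, ⟨l, rfl⟩, by ext <;> simp <;> ring⟩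

lemma image_map_shear_desSpread {a d : F} (ha : a ≠ 0) (hd : d ≠ 0) (b : F) :
    Submodule.map (shear σ a b d) '' desSpread σ = desSpread σ := by
  ext M
  constructor
  · rintro ⟨_, ⟨w, hw, rfl⟩, rfl⟩
    exact ⟨_, fun h0 => hw ((shear_bijective ha hd b).1 (h0.trans (map_zero _).symm)),
      map_shear_fieldLine a b d w⟩
  · rintro ⟨w, hw, rfl⟩
    obtain ⟨v, rfl⟩ := (shear_bijective (σ := σ) ha hd b).2 w
    exact ⟨_, ⟨v, by rintro rfl; simp at hw, rfl⟩, map_shear_fieldLine a b d v⟩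

/-- A line of the plane over the fixed field that meets the line `y = 0`. -/
def meetingLine (σ : F →+* F) (m p r : F) : Submodule (fixedField σ) (F × F) :=
  (subLine σ 1).map (shear σ m p r)

lemma mem_meetingLine {m p r : F} {x : F × F} : x ∈ meetingLine σ m p r ↔
    ∃ a b : F, σ a = a ∧ σ b = b ∧ x = (m * a + p * b, r * b) := by
  simp only [meetingLine, Submodule.mem_map, mem_subLine, one_mul]
  constructor
  · rintro ⟨_, ⟨a, b, ha, hb, rfl⟩, rfl⟩; exact ⟨a, b, ha, hb, rfl⟩
  · rintro ⟨a, b, ha, hb, rfl⟩; exact ⟨_, ⟨a, b, ha, hb, rfl⟩, rfl⟩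

lemma finrank_meetingLine {m r : F} (hm : m ≠ 0) (hr : r ≠ 0) (p : F) :
    Module.finrank (fixedField σ) (meetingLine σ m p r) = 2 := by
  rw [meetingLine, finrank_map_of_injective (shear_bijective hm hr p).1,
    finrank_subLine one_ne_zero]

lemma map_shear_subLine (a b d c : F) :
    (subLine σ c).map (shear σ a b d) = meetingLine σ (a * c) (b * c) (d * c) := by
  ext x
  simp only [mem_meetingLine, Submodule.mem_map, mem_subLine]
  constructor
  · rintro ⟨_, ⟨y, z, hy, hz, rfl⟩, rfl⟩
    exact ⟨y, z, hy, hz, by ext <;> simp <;> ring⟩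
  · rintro ⟨y, z, hy, hz, rfl⟩
    exact ⟨_, ⟨y, z, hy, hz, rfl⟩, by ext <;> simp <;> ring⟩

lemma IsQuadConj.exists_graph (h : IsQuadConj σ) {M : Submodule (fixedField σ) (F × F)}
    (hM : Module.finrank (fixedField σ) M = 2) (h0 : ∀ w ∈ M, w.2 = 0 → w = 0) :
    ∃ a b, M = graphLine σ a b := by
  have hfin : Module.Finite (fixedField σ) M := Module.finite_of_finrank_pos (by omega)
  have hfin' : Module.Finite (fixedField σ) F :=
    Module.finite_of_finrank_pos (by have := h.finrank; omega)
  let g : M →ₗ[fixedField σ] F := (LinearMap.snd (fixedField σ) F F).comp M.subtype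
  have hg : Function.Injective g := by
    refine (injective_iff_map_eq_zero _).2 fun w hw => ?_
    exact Subtype.ext (h0 w w.2 hw)
  have hs := (LinearMap.injective_iff_surjective_of_finrank_eq_finrank
    (hM.trans h.finrank.symm)).1 hg
  obtain ⟨y, hy⟩ := h.ne
  obtain ⟨⟨⟨p, p'⟩, hp⟩, rfl : p' = 1⟩ := hs 1
  obtain ⟨⟨⟨r, r'⟩, hr⟩, rfl : r' = y⟩ := hs y
  have hy' : r' - σ r' ≠ 0 := fun h0 => hy (sub_eq_zero.1 h0).symm
  have hind : LinearIndependent (fixedField σ) ![((p, 1) : F × F), (r, r')] := by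
    rw [LinearIndependent.pair_iff]
    intro a b hab
    have e : (a : F) + b * r' = 0 := by simpa [Subfield.smul_def] using congrArg Prod.snd hab
    have e' := congrArg σ e
    simp only [map_add, map_mul, fixedField.coe_eq, map_zero] at e'
    have hb : (b : F) = 0 := by
      have : (b : F) * (r' - σ r') = 0 := by linear_combination e - e'
      exact (mul_eq_zero.1 this).resolve_right hy'
    have ha : (a : F) = 0 := by rw [hb, zero_mul, add_zero] at e; exact e
    exact ⟨Subtype.ext ha, Subtype.ext hb⟩
  refine ⟨(r - p * σ r') / (r' - σ r'), (p * r' - r) / (r' - σ r'), ?_⟩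
  refine eq_of_le_of_finrank_eq_two (fun x hx => ?_) hM (h.finrank_graphLine _ _)
  obtain ⟨a, b, rfl⟩ := exists_combination_of_finrank_eq_two hM hp hr hind hx
  refine Submodule.add_mem _ (Submodule.smul_mem _ _ ?_) (Submodule.smul_mem _ _ ?_) <;>
  · simp only [mem_graphLine, map_one]
    field_simp
    ring

/-- Classification of the lines of the plane over the fixed field. -/
lemma IsQuadConj.classification (h : IsQuadConj σ) {M : Submodule (fixedField σ) (F × F)}
    (hM : Module.finrank (fixedField σ) M = 2) :
    M ∈ desSpread σ ∨ (∃ a b, b ≠ 0 ∧ M = graphLine σ a b) ∨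
      ∃ m p r, m ≠ 0 ∧ r ≠ 0 ∧ M = meetingLine σ m p r := by
  by_cases h0 : ∀ w ∈ M, w.2 = 0 → w = 0
  · obtain ⟨a, b, rfl⟩ := h.exists_graph hM h0
    by_cases hb : b = 0
    · exact Or.inl ⟨(a, 1), by simp, by rw [hb, fieldLine_eq_graphLine]⟩
    · exact Or.inr (Or.inl ⟨a, b, hb, rfl⟩)
  · push Not at h0
    obtain ⟨⟨m, m'⟩, hm, rfl : m' = 0, hm0⟩ := h0
    have hm0 : m ≠ 0 := by rintro rfl; exact hm0 rfl
    by_cases h1 : ∀ w ∈ M, w.2 = 0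
    · refine Or.inl ⟨(1, 0), by simp, ?_⟩
      refine eq_of_le_of_finrank_eq_two (fun x hx => ?_) hM (h.finrank_fieldLine (by simp))
      exact mem_fieldLine.2 ⟨x.1, Prod.ext (by simp) (by simp [h1 x hx])⟩
    · push Not at h1
      obtain ⟨⟨p, r⟩, hp, hr : r ≠ 0⟩ := h1
      refine Or.inr (Or.inr ⟨m, p, r, hm0, hr, Eq.symm ?_⟩)
      refine eq_of_le_of_finrank_eq_two (fun x hx => ?_) (finrank_meetingLine hm0 hr p) hM
      obtain ⟨a, b, ha, hb, hx⟩ := mem_meetingLine.1 hx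
      have : x = (⟨a, ha⟩ : fixedField σ) • ((m, 0) : F × F) +
          (⟨b, hb⟩ : fixedField σ) • ((p, r) : F × F) := by
        rw [hx]; ext <;> simp [Subfield.smul_def, mul_comm]
      rw [this]
      exact M.add_mem (M.smul_mem _ hm) (M.smul_mem _ hp)

variable {k : F}

lemma graphLine_notMem_desSpread (h : IsQuadConj σ) {a b : F} (hb : b ≠ 0) :
    graphLine σ a b ∉ desSpread σ := by
  rintro ⟨w, hw, he⟩
  rcases exists_fieldLine_normal_form (σ := σ) hw with h' | ⟨s, h'⟩
  · have : ((1, 0) : F × F) ∈ graphLine σ a b := by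
      rw [he, h']; exact self_mem_fieldLine _
    simp [mem_graphLine] at this
  · rw [h', fieldLine_eq_graphLine] at he
    exact hb (graphLine_injective h he).2

lemma meetingLine_notMem_desSpread {m p r : F} (hm : m ≠ 0) (hr : r ≠ 0) :
    meetingLine σ m p r ∉ desSpread σ := by
  rintro ⟨w, hw, he⟩
  have h1 : ((m, 0) : F × F) ∈ fieldLine σ w := by
    rw [← he, mem_meetingLine]; exact ⟨1, 0, by simp⟩
  have h2 : ((p, r) : F × F) ∈ fieldLine σ w := by
    rw [← he, mem_meetingLine]; exact ⟨0, 1, by simp⟩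
  rw [fieldLine_eq_of_mem h1 (by simp [hm]), mem_fieldLine] at h2
  obtain ⟨l, hl⟩ := h2
  exact hr (by simpa using congrArg Prod.snd hl)

lemma disjoint_switchedSpread_desSpread (h : IsQuadConj σ) (hk : k * σ k ≠ 1) (hk0 : k ≠ 0) :
    Disjoint (switchedSpread σ k) (desSpread σ) := by
  rw [Set.disjoint_left]
  rintro M (hM | hM) hD
  · exact hM.2 ⟨hD, hM.1⟩
  · obtain ⟨c, hc, rfl⟩ := (mem_transversals h hk hk0).1 hM
    have hc' : subLine σ c = meetingLine σ c 0 c := by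
      have := map_shear_subLine (σ := σ) 1 0 1 c
      rw [one_mul, zero_mul] at this
      rw [← this]
      convert (Submodule.map_id _).symm
      ext w <;> simp
    exact meetingLine_notMem_desSpread hc hc (hc' ▸ hD)

lemma graphLine_mem_switchedSpread (h : IsQuadConj σ) (hk : k * σ k ≠ 1) (hk0 : k ≠ 0)
    {a c : F} (hc : c ≠ 0) : graphLine σ a (k * c) ∈ switchedSpread σ k ↔
      σ c = -c ∧ σ a - a = (1 + k * σ k) * c := by
  have hdes := graphLine_notMem_desSpread h (a := a) (mul_ne_zero hk0 hc)
  have hsub : graphLine σ a (k * c) ∉ transversals σ (desSpread σ ∩ twistSpread σ k) := by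
    rw [mem_transversals h hk hk0]
    rintro ⟨d, hd, he⟩
    have : ((d, 0) : F × F) ∈ graphLine σ a (k * c) := by
      rw [he, mem_subLine]; exact ⟨1, 0, by simp⟩
    simp [mem_graphLine, hd] at this
  have h1 : graphLine σ a (k * c) ∈ switchedSpread σ k ↔
      graphLine σ a (k * c) ∈ twistSpread σ k :=
    ⟨fun hm => (hm.resolve_right hsub).1, fun hm => Or.inl ⟨hm, fun h2 => hdes h2.1⟩⟩
  have h2 : graphLine σ a (k * c) ∈ twistSpread σ k ↔
      ∃ s, (fieldLine σ (s, 1)).map (twistPair σ k) = graphLine σ a (k * c) := by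
    constructor
    · rintro ⟨_, ⟨w, hw, rfl⟩, he⟩
      rcases exists_fieldLine_normal_form (σ := σ) hw with h' | ⟨s, h'⟩
      · rw [h', map_twistPair_fieldLine_fixed h hk (by simp) (by simp)] at he
        exact absurd ⟨(1, 0), by simp, he.symm⟩ hdes
      · exact ⟨s, h' ▸ he⟩
    · rintro ⟨s, hs⟩
      exact ⟨_, ⟨(s, 1), by simp, rfl⟩, hs⟩
  rw [h1, h2]
  simp only [map_twistPair_fieldLine_eq_graphLine_iff h hk]
  have hn : 1 - k * σ k ≠ 0 := fun h0 => hk (sub_eq_zero.1 h0).symm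
  constructor
  · rintro ⟨s, e1, e2⟩
    have e2 : σ s = a + c := mul_left_cancel₀ hk0 (by linear_combination e2)
    have e3 := congrArg σ e1
    simp only [map_add, map_mul, h.involutive] at e3
    have e4 := congrArg σ e2
    simp only [map_add, h.involutive] at e4
    have : (1 - k * σ k) * (σ c + c) = 0 := by
      linear_combination e3 - e2 + e1 - e4
    have hc' : σ c = -c := by
      linear_combination (mul_eq_zero.1 this).resolve_left hn
    exact ⟨hc', by linear_combination e2 - e3 - k * σ k * hc'⟩
  · rintro ⟨e1, e2⟩
    refine ⟨a + k * c * σ k, rfl, ?_⟩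
    simp only [map_add, map_mul, h.involutive, e1]
    linear_combination k * e2

/-- Membership of the lines disjoint from `y = 0` in a sheared switched spread. -/
lemma graphLine_mem_image (h : IsQuadConj σ) (hk : k * σ k ≠ 1) (hk0 : k ≠ 0)
    {x₀ y₀ : F} (hx₀ : x₀ ≠ 0) (hy₀ : y₀ ≠ 0) (x : F) {a b : F} (hb : b ≠ 0) :
    graphLine σ a b ∈ Submodule.map (shear σ x₀ x y₀) '' switchedSpread σ k ↔
      σ (b * σ y₀ / (x₀ * k)) = -(b * σ y₀ / (x₀ * k)) ∧
      σ ((a * y₀ - x) / x₀) - (a * y₀ - x) / x₀ =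
        (1 + k * σ k) * (b * σ y₀ / (x₀ * k)) := by
  have hs : σ y₀ ≠ 0 := (map_ne_zero σ).2 hy₀
  rw [← graphLine_mem_switchedSpread h hk hk0
    (div_ne_zero (mul_ne_zero hb hs) (mul_ne_zero hx₀ hk0))]
  have he : graphLine σ a b = (graphLine σ ((a * y₀ - x) / x₀)
      (k * (b * σ y₀ / (x₀ * k)))).map (shear σ x₀ x y₀) := by
    refine (eq_of_le_of_finrank_eq_two ?_ ?_ (h.finrank_graphLine a b)).symm
    · rintro _ ⟨w, hw, rfl⟩
      rw [SetLike.mem_coe, mem_graphLine] at hw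
      simp only [mem_graphLine, shear_apply, map_mul, hw]
      field_simp
      ring
    · rw [finrank_map_of_injective (shear_bijective hx₀ hy₀ x).1, h.finrank_graphLine]
  rw [he, (map_shear_injective hx₀ hy₀ x).mem_set_image]

lemma exists_graphLine_mem_image_iff (h : IsQuadConj σ) (hk : k * σ k ≠ 1) (hk0 : k ≠ 0)
    {x₀ y₀ u v : F} (hx₀ : x₀ ≠ 0) (hy₀ : y₀ ≠ 0) (hu : σ x₀ = u * x₀) (hv : σ y₀ = v * y₀)
    {a b : F} (hb : b ≠ 0) :
    (∃ x, graphLine σ a b ∈ Submodule.map (shear σ x₀ x y₀) '' switchedSpread σ k) ↔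
      σ b * k = -(b * (u * v * σ k)) := by
  simp only [graphLine_mem_image h hk hk0 hx₀ hy₀ _ hb]
  have hs : σ k ≠ 0 := (map_ne_zero σ).2 hk0
  have hu0 : u ≠ 0 := by rintro rfl; simp [hx₀] at hu
  have key : σ (b * σ y₀ / (x₀ * k)) = -(b * σ y₀ / (x₀ * k)) ↔
      σ b * k = -(b * (u * v * σ k)) := by
    have e0 : σ (b * σ y₀ / (x₀ * k)) = σ b * y₀ / (u * x₀ * σ k) := by
      rw [map_div₀, map_mul, map_mul, h.involutive, hu]
    rw [e0, hv, ← neg_div, div_eq_div_iff (by simp [*]) (by simp [*])]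
    constructor
    · intro e
      exact mul_left_cancel₀ (mul_ne_zero hx₀ hy₀) (by linear_combination e)
    · intro e
      linear_combination x₀ * y₀ * e
  rw [← key]
  refine ⟨fun ⟨x, hx⟩ => hx.1, fun e => ?_⟩
  obtain ⟨z, hz⟩ := h.exists_sub_eq (d := (1 + k * σ k) * (b * σ y₀ / (x₀ * k))) (by
    rw [map_mul, e]
    simp only [map_add, map_mul, map_one, h.involutive]
    ring)
  refine ⟨a * y₀ - x₀ * z, e, ?_⟩
  rw [sub_sub_cancel, mul_div_cancel_left₀ _ hx₀, hz]

lemma graphLine_mem_image_unique (h : IsQuadConj σ) (hk : k * σ k ≠ 1) (hk0 : k ≠ 0)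
    {x₀ y₀ : F} (hx₀ : x₀ ≠ 0) (hy₀ : y₀ ≠ 0) {a b : F} (hb : b ≠ 0) {x x' : F}
    (hx : graphLine σ a b ∈ Submodule.map (shear σ x₀ x y₀) '' switchedSpread σ k)
    (hx' : graphLine σ a b ∈ Submodule.map (shear σ x₀ x' y₀) '' switchedSpread σ k) :
    σ ((x - x') / x₀) = (x - x') / x₀ := by
  rw [graphLine_mem_image h hk hk0 hx₀ hy₀ _ hb] at hx hx'
  have e := hx'.2.trans hx.2.symm
  simp only [map_div₀, map_sub, sub_div] at e ⊢
  linear_combination e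

lemma meetingLine_eq_iff {m p r m' p' r' : F} (hm : m ≠ 0) (hr : r ≠ 0)
    (hm' : m' ≠ 0) (hr' : r' ≠ 0) :
    meetingLine σ m p r = meetingLine σ m' p' r' ↔
      σ (m / m') = m / m' ∧ σ (r / r') = r / r' ∧
        σ ((p - p' * (r / r')) / m') = (p - p' * (r / r')) / m' := by
  constructor
  · intro he
    have h1 : ((m, 0) : F × F) ∈ meetingLine σ m' p' r' := by
      rw [← he, mem_meetingLine]; exact ⟨1, 0, by simp⟩
    have h2 : ((p, r) : F × F) ∈ meetingLine σ m' p' r' := by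
      rw [← he, mem_meetingLine]; exact ⟨0, 1, by simp⟩
    obtain ⟨a, b, ha, hb, hab⟩ := mem_meetingLine.1 h1
    obtain ⟨c, d, hc, hd, hcd⟩ := mem_meetingLine.1 h2
    obtain ⟨e1, e2⟩ := Prod.mk.inj hab
    obtain ⟨e3, e4⟩ := Prod.mk.inj hcd
    obtain rfl : b = 0 := by simpa [hr'] using e2.symm
    have f1 : m / m' = a := by rw [e1]; field_simp; ring
    have f2 : r / r' = d := by rw [e4]; field_simp
    have f3 : (p - p' * d) / m' = c := by rw [e3]; field_simp; ring
    rw [f1, f2, f3]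
    exact ⟨ha, hd, hc⟩
  · rintro ⟨e1, e2, e3⟩
    refine eq_of_le_of_finrank_eq_two ?_ (finrank_meetingLine hm hr p)
      (finrank_meetingLine hm' hr' p')
    intro x hx
    obtain ⟨a, b, ha, hb, rfl⟩ := mem_meetingLine.1 hx
    refine mem_meetingLine.2 ⟨m / m' * a + (p - p' * (r / r')) / m' * b, r / r' * b,
      ?_, ?_, ?_⟩
    · rw [map_add, map_mul, map_mul, e1, e3, ha, hb]
    · rw [map_mul, e2, hb]
    · ext <;> simp <;> field_simp
      ring

/-- Membership of the lines meeting `y = 0` in a sheared switched spread. -/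
lemma meetingLine_mem_image (h : IsQuadConj σ) (hk : k * σ k ≠ 1) (hk0 : k ≠ 0)
    {x₀ y₀ : F} (hx₀ : x₀ ≠ 0) (hy₀ : y₀ ≠ 0) (x : F) {m p r : F} (hm : m ≠ 0) :
    meetingLine σ m p r ∈ Submodule.map (shear σ x₀ x y₀) '' switchedSpread σ k ↔
      ∃ c ≠ 0, meetingLine σ m p r = meetingLine σ (x₀ * c) (x * c) (y₀ * c) := by
  constructor
  · rintro ⟨N, hN | hN, he⟩
    · have hmem : ((m / x₀, 0) : F × F) ∈ N := by
        have : shear σ x₀ x y₀ (m / x₀, 0) ∈ N.map (shear σ x₀ x y₀) := by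
          rw [he, mem_meetingLine]
          exact ⟨1, 0, by simp, by simp, by ext <;> simp; field_simp⟩
        obtain ⟨w, hw, e⟩ := this
        rwa [(shear_bijective hx₀ hy₀ x).1 e] at hw
      have hw : ((m / x₀, 0) : F × F) ≠ 0 := by simp [hm, hx₀]
      have hreg := (mem_desSpread_inter_twistSpread h hk hk0).2
        ⟨(1, 0), by simp, by simp, by simp, rfl⟩
      have := ((isVectorSpread_twistSpread h hk).2 _ hw).unique ⟨hN.1, hmem⟩
        ⟨hreg.2, mem_fieldLine.2 ⟨m / x₀, by simp⟩⟩
      exact absurd (this ▸ hreg) hN.2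
    · obtain ⟨c, hc, rfl⟩ := (mem_transversals h hk hk0).1 hN
      exact ⟨c, hc, by rw [← he, map_shear_subLine]⟩
  · rintro ⟨c, hc, he⟩
    rw [he, ← map_shear_subLine]
    exact ⟨_, Or.inr ((mem_transversals h hk hk0).2 ⟨c, hc, rfl⟩), rfl⟩

lemma exists_meetingLine_mem_image_iff (h : IsQuadConj σ) (hk : k * σ k ≠ 1) (hk0 : k ≠ 0)
    {x₀ y₀ u v : F} (hx₀ : x₀ ≠ 0) (hy₀ : y₀ ≠ 0) (hu : σ x₀ = u * x₀) (hv : σ y₀ = v * y₀)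
    {m p r : F} (hm : m ≠ 0) (hr : r ≠ 0) :
    (∃ x, meetingLine σ m p r ∈ Submodule.map (shear σ x₀ x y₀) '' switchedSpread σ k) ↔
      σ r * m * u = r * σ m * v := by
  have hsm : σ m ≠ 0 := (map_ne_zero σ).2 hm
  have hu0 : u ≠ 0 := by rintro rfl; simp [hx₀] at hu
  have hv0 : v ≠ 0 := by rintro rfl; simp [hy₀] at hv
  simp only [meetingLine_mem_image h hk hk0 hx₀ hy₀ _ hm]
  constructor
  · rintro ⟨x, c, hc, he⟩
    have hsc : σ c ≠ 0 := (map_ne_zero σ).2 hc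
    obtain ⟨e1, e2, -⟩ := (meetingLine_eq_iff hm hr (by simp [*]) (by simp [*])).1 he
    simp only [map_div₀, map_mul, hu, hv] at e1 e2
    field_simp at e1 e2
    refine mul_left_cancel₀ hc ?_
    linear_combination m * u * e2 - r * v * e1
  · intro e
    refine ⟨p * y₀ / r, m / x₀, by simp [*],
      (meetingLine_eq_iff hm hr (by simp [*]) (by simp [*])).2 ⟨?_, ?_, ?_⟩⟩
    · rw [mul_div_cancel₀ _ hx₀, div_self hm, map_one]
    · simp only [map_div₀, map_mul, hu, hv]
      field_simp
      linear_combination e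
    · have : p - p * y₀ / r * (m / x₀) * (r / (y₀ * (m / x₀))) = 0 := by field_simp; ring
      rw [this, zero_div, map_zero]

lemma meetingLine_mem_image_unique (h : IsQuadConj σ) (hk : k * σ k ≠ 1) (hk0 : k ≠ 0)
    {x₀ y₀ : F} (hx₀ : x₀ ≠ 0) (hy₀ : y₀ ≠ 0) {m p r : F} (hm : m ≠ 0) {x x' : F}
    (hx : meetingLine σ m p r ∈ Submodule.map (shear σ x₀ x y₀) '' switchedSpread σ k)
    (hx' : meetingLine σ m p r ∈ Submodule.map (shear σ x₀ x' y₀) '' switchedSpread σ k) :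
    σ ((x - x') / x₀) = (x - x') / x₀ := by
  rw [meetingLine_mem_image h hk hk0 hx₀ hy₀ _ hm] at hx hx'
  obtain ⟨c, hc, he⟩ := hx
  obtain ⟨d, hd, he'⟩ := hx'
  obtain ⟨e1, e2, e3⟩ := (meetingLine_eq_iff (by simp [*]) (by simp [*]) (by simp [*])
    (by simp [*])).1 (he.symm.trans he')
  have f : (x * c - x' * d * (y₀ * c / (y₀ * d))) / (x₀ * d) =
      (x₀ * c / (x₀ * d)) * ((x - x') / x₀) := by field_simp
  rw [f, map_mul, e1] at e3
  exact mul_left_cancel₀ (by simp [*]) e3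

end Shear

section Baer

variable {F : Type} [Field F] {σ : F →+* F}

lemma exists_linearIndependent_pair {k V : Type*} [Field k] [AddCommGroup V] [Module k V]
    {M : Submodule k V} (hM : Module.finrank k M = 2) :
    ∃ v w, v ∈ M ∧ w ∈ M ∧ LinearIndependent k ![v, w] := by
  have : Module.Finite k M := Module.finite_of_finrank_pos (by omega)
  let b := Module.finBasisOfFinrankEq k M hM
  refine ⟨b 0, b 1, (b 0).2, (b 1).2, ?_⟩
  have := b.linearIndependent.map' M.subtype (Submodule.ker_subtype M)
  have he : ![(b 0 : V), b 1] = M.subtype ∘ b := by ext i; fin_cases i <;> rfl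
  rwa [he]

lemma finrank_span_pair {k V : Type*} [Field k] [AddCommGroup V] [Module k V] {v w : V}
    (h : LinearIndependent k ![v, w]) : Module.finrank k (Submodule.span k {v, w}) = 2 := by
  have := finrank_span_eq_card h
  rwa [Matrix.range_cons_cons_empty, Fintype.card_fin] at this

variable (σ)

/-- The parametrisation of the Baer subgeometry `Σ_α`. -/
def baerMap (α : F) : F × F →ₗ[fixedField σ] (Fin 4 → F) where
  toFun w := ![w.1, w.2, α * σ w.1, α * σ w.2]
  map_add' v w := by ext i; fin_cases i <;> simp <;> ring
  map_smul' c w := by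
    ext i; fin_cases i <;> simp [Subfield.smul_def, fixedField.coe_eq] <;> ring

lemma baerMap_apply (α : F) (w : F × F) :
    baerMap σ α w = ![w.1, w.2, α * σ w.1, α * σ w.2] := rfl

/-- The set of points of `Σ_α` parametrised by a subspace. -/
def pts (α : F) (M : Submodule (fixedField σ) (F × F)) : Set (Pt F) :=
  {P | ∃ w ∈ M, ∃ h : baerMap σ α w ≠ 0, P = Projectivization.mk F (baerMap σ α w) h}

variable {σ} {α : F}

lemma baerMap_ne_zero {w : F × F} : baerMap σ α w ≠ 0 ↔ w ≠ 0 := by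
  rw [not_iff_not]
  constructor
  · intro h; exact Prod.ext (congrFun h 0) (congrFun h 1)
  · rintro rfl; exact map_zero _

lemma baerMap_injective : Function.Injective (baerMap σ α) := by
  refine (injective_iff_map_eq_zero _).2 fun w hw => ?_
  by_contra h
  exact baerMap_ne_zero.2 h hw

lemma eq_smul_of_baerMap_eq (hα : α ≠ 0) {v w : F × F} (hv : v ≠ 0) {c : F}
    (h : c • baerMap σ α v = baerMap σ α w) : σ c = c ∧ w = c • v := by
  have h0 := congrFun h 0
  have h1 := congrFun h 1
  have h2 := congrFun h 2
  have h3 := congrFun h 3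
  simp only [baerMap_apply, Pi.smul_apply, smul_eq_mul, Matrix.cons_val] at h0 h1 h2 h3
  refine ⟨?_, Prod.ext h0.symm h1.symm⟩
  have key : ∀ x y : F, c * x = y → c * (α * σ x) = α * σ y → x ≠ 0 → σ c = c := by
    rintro x _ rfl e hx
    rw [map_mul] at e
    exact mul_right_cancel₀ (mul_ne_zero hα ((map_ne_zero σ).2 hx)) (by linear_combination -e)
  by_cases hv1 : v.1 = 0
  · exact key _ _ h1 h3 fun hv2 => hv (Prod.ext hv1 hv2)
  · exact key _ _ h0 h2 hv1

lemma mk_mem_pts (hα : α ≠ 0) {M : Submodule (fixedField σ) (F × F)} {w : F × F}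
    (h : baerMap σ α w ≠ 0) : Projectivization.mk F (baerMap σ α w) h ∈ pts σ α M ↔ w ∈ M := by
  constructor
  · rintro ⟨v, hv, hv0, he⟩
    obtain ⟨c, hc⟩ := (Projectivization.mk_eq_mk_iff' F _ _ h hv0).1 he
    obtain ⟨h1, rfl⟩ := eq_smul_of_baerMap_eq hα (baerMap_ne_zero.1 hv0) hc
    exact M.smul_mem (⟨c, h1⟩ : fixedField σ) hv
  · intro hw; exact ⟨w, hw, h, rfl⟩

lemma pts_injective (hα : α ≠ 0) : Function.Injective (pts σ α) := by
  have key : ∀ M N : Submodule (fixedField σ) (F × F), pts σ α M = pts σ α N → M ≤ N := by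
    intro M N he w hw
    by_cases h0 : w = 0
    · rw [h0]; exact N.zero_mem
    · rw [← mk_mem_pts hα (baerMap_ne_zero.2 h0), ← he, mk_mem_pts hα]; exact hw
  exact fun M N he => le_antisymm (key M N he) (key N M he.symm)

lemma pts_inter_nonempty_iff (hα : α ≠ 0) {M N : Submodule (fixedField σ) (F × F)} :
    (pts σ α M ∩ pts σ α N).Nonempty ↔ ∃ w ≠ 0, w ∈ M ∧ w ∈ N := by
  constructor
  · rintro ⟨_, ⟨w, hw, h0, rfl⟩, hN⟩
    exact ⟨w, baerMap_ne_zero.1 h0, hw, (mk_mem_pts hα h0).1 hN⟩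
  · rintro ⟨w, h0, hM, hN⟩
    exact ⟨Projectivization.mk F _ (baerMap_ne_zero.2 h0), (mk_mem_pts hα _).2 hM,
      (mk_mem_pts hα _).2 hN⟩

variable {q : ℕ}

lemma mem_SigmaSet (hσ : ∀ x, σ x = x ^ q) {P : Pt F} : P ∈ SigmaSet q F α ↔
    ∃ w, ∃ h : baerMap σ α w ≠ 0, P = Projectivization.mk F (baerMap σ α w) h := by
  simp only [SigmaSet, Set.mem_ofPred_eq, ← hσ]
  exact ⟨fun ⟨x, y, h, e⟩ => ⟨(x, y), h, e⟩, fun ⟨w, h, e⟩ => ⟨w.1, w.2, h, e⟩⟩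

lemma inter_SigmaSet (hσ : ∀ x, σ x = x ^ q) {W : Submodule F (Fin 4 → F)}
    {M : Submodule (fixedField σ) (F × F)} (hM : ∀ w, w ∈ M ↔ baerMap σ α w ∈ W) :
    {P : Pt F | P.submodule ≤ W} ∩ SigmaSet q F α = pts σ α M := by
  ext P
  simp only [Set.mem_inter_iff, Set.mem_ofPred_eq, mem_SigmaSet hσ, pts]
  constructor
  · rintro ⟨hP, w, h, rfl⟩
    refine ⟨w, (hM w).2 ?_, h, rfl⟩
    rwa [Projectivization.submodule_mk, Submodule.span_singleton_le_iff_mem] at hP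
  · rintro ⟨w, hw, h, rfl⟩
    refine ⟨?_, w, h, rfl⟩
    rwa [Projectivization.submodule_mk, Submodule.span_singleton_le_iff_mem, ← hM]

lemma fixed_of_combination (hs : IsQuadConj σ) (hα : α ≠ 0) {v w x : F × F}
    (hvw : LinearIndependent F ![baerMap σ α v, baerMap σ α w]) {a b : F}
    (h : a • baerMap σ α v + b • baerMap σ α w = baerMap σ α x) : σ a = a ∧ σ b = b := by
  have h0 := congrFun h 0
  have h1 := congrFun h 1
  have h2 := congrFun h 2
  have h3 := congrFun h 3
  simp only [baerMap_apply, Pi.smul_apply, Pi.add_apply, smul_eq_mul, Matrix.cons_val]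
    at h0 h1 h2 h3
  have key : ∀ {r s t : F}, a * r + b * s = t → a * (α * σ r) + b * (α * σ s) = α * σ t →
      (σ a - a) * σ r + (σ b - b) * σ s = 0 ∧ (σ a - a) * r + (σ b - b) * s = 0 := by
    rintro r s _ rfl e
    rw [map_add, map_mul, map_mul] at e
    have e' : (σ a - a) * σ r + (σ b - b) * σ s = 0 :=
      mul_left_cancel₀ hα (by linear_combination -e)
    have e'' := congrArg σ e'
    simp only [map_add, map_mul, map_sub, hs.involutive, map_zero] at e''
    exact ⟨e', by linear_combination -e''⟩
  obtain ⟨e2, e0⟩ := key h0 h2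
  obtain ⟨e3, e1⟩ := key h1 h3
  have := LinearIndependent.pair_iff.1 hvw (σ a - a) (σ b - b) (by
    ext i
    fin_cases i <;> simp only [baerMap_apply, Pi.smul_apply, Pi.add_apply, smul_eq_mul,
      Matrix.cons_val, Pi.zero_apply, Fin.zero_eta, Fin.mk_one, Fin.reduceFinMk]
    · exact e0
    · exact e1
    · linear_combination α * e2
    · linear_combination α * e3)
  exact ⟨sub_eq_zero.1 this.1, sub_eq_zero.1 this.2⟩

lemma linearIndependent_baerMap (hα : α ≠ 0) {v w : F × F}
    (hvw : LinearIndependent (fixedField σ) ![v, w]) :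
    LinearIndependent F ![baerMap σ α v, baerMap σ α w] := by
  have hv : v ≠ 0 := hvw.ne_zero 0
  rw [LinearIndependent.pair_iff'] at hvw ⊢
  · intro c hc
    obtain ⟨h1, h2⟩ := eq_smul_of_baerMap_eq hα hv hc
    exact hvw ⟨c, h1⟩ h2.symm
  · exact baerMap_ne_zero.2 hv
  · exact hv

lemma mem_iff_baerMap_mem (h : IsQuadConj σ) (hα : α ≠ 0) {W : Submodule F (Fin 4 → F)}
    (hW : Module.finrank F W = 2) {M : Submodule (fixedField σ) (F × F)}
    (hM : Module.finrank (fixedField σ) M = 2) (hMW : ∀ w ∈ M, baerMap σ α w ∈ W) (w : F × F) :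
    w ∈ M ↔ baerMap σ α w ∈ W := by
  refine ⟨hMW w, fun hw => ?_⟩
  obtain ⟨v₁, v₂, h1, h2, hv⟩ := exists_linearIndependent_pair hM
  have hv' := linearIndependent_baerMap hα hv
  obtain ⟨a, b, hab⟩ := exists_combination_of_finrank_eq_two hW (hMW _ h1) (hMW _ h2) hv' hw
  obtain ⟨ha, hb⟩ := fixed_of_combination h hα hv' hab
  have : w = (⟨a, ha⟩ : fixedField σ) • v₁ + (⟨b, hb⟩ : fixedField σ) • v₂ := by
    apply baerMap_injective (σ := σ) (α := α)
    rw [map_add, map_smul, map_smul, ← hab]; rfl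
  rw [this]
  exact M.add_mem (M.smul_mem _ h1) (M.smul_mem _ h2)

lemma ncard_pts [Finite F] (hα : α ≠ 0) (hcard : Nat.card (fixedField σ) = q)
    {M : Submodule (fixedField σ) (F × F)} (hM : Module.finrank (fixedField σ) M = 2) :
    (pts σ α M).ncard = q + 1 := by
  rw [← hcard, ← Projectivization.card_of_finrank_two (fixedField σ) M hM]
  let f : Projectivization (fixedField σ) M → Pt F := fun P =>
    Projectivization.mk F (baerMap σ α (P.rep : F × F))
      (baerMap_ne_zero.2 fun h => P.rep_nonzero (Subtype.ext h))
  have hf : Function.Injective f := by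
    intro P Q hPQ
    obtain ⟨c, hc⟩ := (Projectivization.mk_eq_mk_iff' F _ _ _ _).1 hPQ
    obtain ⟨h1, h2⟩ := eq_smul_of_baerMap_eq hα
      (fun h => Q.rep_nonzero (Subtype.ext h)) hc
    rw [← P.mk_rep, ← Q.mk_rep, Projectivization.mk_eq_mk_iff']
    exact ⟨⟨c, h1⟩, Subtype.ext h2.symm⟩
  have : pts σ α M = Set.range f := by
    ext P
    constructor
    · rintro ⟨w, hw, h0, rfl⟩
      have hw0 : (⟨w, hw⟩ : M) ≠ 0 := fun h => baerMap_ne_zero.1 h0 (congrArg Subtype.val h)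
      refine ⟨Projectivization.mk (fixedField σ) ⟨w, hw⟩ hw0, ?_⟩
      obtain ⟨a, ha⟩ := Projectivization.exists_smul_eq_mk_rep (fixedField σ) _ hw0
      refine (Projectivization.mk_eq_mk_iff' F _ _ _ _).2 ⟨((a : fixedField σ) : F), ?_⟩
      rw [← ha]
      exact (map_smul (baerMap σ α) (a : fixedField σ) w).symm
    · rintro ⟨P, rfl⟩
      exact ⟨_, P.rep.2, _, rfl⟩
  rw [this, ← Nat.card_coe_set_eq, Nat.card_range_of_injective hf]

/-- Two distinct points of `Σ_α` are given by independent vectors. -/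
lemma linearIndependent_of_mk_ne {v w : F × F} (hv : baerMap σ α v ≠ 0) (hw : baerMap σ α w ≠ 0)
    (h : Projectivization.mk F _ hv ≠ Projectivization.mk F _ hw) :
    LinearIndependent (fixedField σ) ![v, w] := by
  rw [LinearIndependent.pair_iff' (baerMap_ne_zero.1 hv)]
  rintro c rfl
  refine h ((Projectivization.mk_eq_mk_iff' F _ _ _ _).2 ?_)
  have hc : (c : F) ≠ 0 := by
    intro hc
    rw [baerMap_ne_zero] at hw
    have hc' : c = 0 := Subtype.ext hc
    exact hw (by rw [hc', zero_smul])
  exact ⟨(c : F)⁻¹, by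
    rw [map_smul, Subfield.smul_def, smul_smul, inv_mul_cancel₀ hc, one_smul]⟩

lemma isLineOfSigma_iff [Finite F] (h : IsQuadConj σ) (hσ : ∀ x, σ x = x ^ q) (hq : 1 ≤ q)
    (hα : α ≠ 0) (hcard : Nat.card (fixedField σ) = q) {m : Set (Pt F)} :
    IsLineOfSigma q F α m ↔
      ∃ M : Submodule (fixedField σ) (F × F),
        Module.finrank (fixedField σ) M = 2 ∧ m = pts σ α M := by
  constructor
  · rintro ⟨_, ⟨W, hW, rfl⟩, rfl, hm⟩
    obtain ⟨P, hP, Q, hQ, hPQ⟩ := (Set.one_lt_ncard (Set.toFinite _)).1 (by rw [hm]; omega)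
    obtain ⟨v, hv, rfl⟩ := (mem_SigmaSet hσ).1 hP.2
    obtain ⟨w, hw, rfl⟩ := (mem_SigmaSet hσ).1 hQ.2
    have hind := linearIndependent_of_mk_ne hv hw hPQ
    have hPW := hP.1
    have hQW := hQ.1
    simp only [Set.mem_ofPred_eq, Projectivization.submodule_mk,
      Submodule.span_singleton_le_iff_mem] at hPW hQW
    refine ⟨Submodule.span (fixedField σ) {v, w}, finrank_span_pair hind,
      inter_SigmaSet hσ (mem_iff_baerMap_mem h hα hW (finrank_span_pair hind) ?_)⟩
    intro x hx
    obtain ⟨a, b, rfl⟩ := Submodule.mem_span_pair.1 hx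
    rw [map_add, map_smul, map_smul]
    exact W.add_mem (W.smul_mem (a : F) hPW) (W.smul_mem (b : F) hQW)
  · rintro ⟨M, hM, rfl⟩
    obtain ⟨v, w, hv, hw, hind⟩ := exists_linearIndependent_pair hM
    have hind' := linearIndependent_baerMap (α := α) hα hind
    refine ⟨_, ⟨_, finrank_span_pair hind', rfl⟩,
      (inter_SigmaSet hσ (mem_iff_baerMap_mem h hα (finrank_span_pair hind') hM ?_)).symm,
      ncard_pts hα hcard hM⟩
    intro x hx
    obtain ⟨a, b, rfl⟩ := exists_combination_of_finrank_eq_two hM hv hw hind hx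
    rw [map_add, map_smul, map_smul]
    exact Submodule.mem_span_pair.2 ⟨(a : F), (b : F), rfl⟩

lemma isSpreadOfSigma_image [Finite F] (h : IsQuadConj σ) (hσ : ∀ x, σ x = x ^ q) (hq : 1 ≤ q)
    (hα : α ≠ 0) (hcard : Nat.card (fixedField σ) = q)
    {S : Set (Submodule (fixedField σ) (F × F))} (hS : IsVectorSpread S) :
    IsSpreadOfSigma q F α (pts σ α '' S) := by
  refine ⟨?_, ?_, ?_⟩
  · rintro _ ⟨M, hM, rfl⟩
    exact (isLineOfSigma_iff h hσ hq hα hcard).2 ⟨M, hS.1 M hM, rfl⟩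
  · rintro _ ⟨M, hM, rfl⟩ _ ⟨N, hN, rfl⟩ hne
    by_contra hi
    obtain ⟨w, hw, hwM, hwN⟩ := (pts_inter_nonempty_iff hα).1 (Set.nonempty_iff_ne_empty.2 hi)
    exact hne (congrArg _ ((hS.2 w hw).unique ⟨hM, hwM⟩ ⟨hN, hwN⟩))
  · ext P
    rw [mem_SigmaSet hσ]
    constructor
    · rintro ⟨_, ⟨M, -, rfl⟩, w, -, h0, rfl⟩; exact ⟨w, h0, rfl⟩
    · rintro ⟨w, h0, rfl⟩
      obtain ⟨M, ⟨hM, hw⟩, -⟩ := hS.2 w (baerMap_ne_zero.1 h0)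
      exact ⟨_, ⟨M, hM, rfl⟩, (mk_mem_pts hα h0).2 hw⟩

end Baer

section Incidence

variable {F : Type} [Field F] {σ : F →+* F} {q : ℕ} {η α : F}

lemma submodule_le_iff_rep_mem {P : Pt F} {W : Submodule F (Fin 4 → F)} :
    P.submodule ≤ W ↔ P.rep ∈ W := by
  rw [Projectivization.submodule_eq, Submodule.span_singleton_le_iff_mem]

variable (σ η) in
/-- The subspace of `Σ_η` corresponding to the line joining the point `X` to its conjugate. -/
def conjLine (X : Fin 4 → F) : Submodule (fixedField σ) (F × F) :=
  LinearMap.range ((twist σ (X 0) (η * σ (X 2))).prod (twist σ (X 1) (η * σ (X 3))))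

lemma mem_conjLine {X : Fin 4 → F} {w : F × F} : w ∈ conjLine σ η X ↔
    ∃ l, w = (l * X 0 + η * σ (l * X 2), l * X 1 + η * σ (l * X 3)) := by
  simp only [conjLine, LinearMap.mem_range, LinearMap.prod_apply, Function.prod_apply,
    twist_apply, map_mul]
  exact exists_congr fun l => by
    rw [eq_comm]
    ring_nf

lemma mul_conj_eq_one (hσ : ∀ x, σ x = x ^ q) (hη : η ^ (q + 1) = 1) : η * σ η = 1 := by
  rw [hσ, ← hη, pow_succ']

lemma tauFun_eq (hσ : ∀ x, σ x = x ^ q) (hη : η ^ (q + 1) = 1) (X : Fin 4 → F) :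
    tauFun q F η X = ![σ (X 2), σ (X 3), σ (X 0), σ (X 1)] := by
  simp only [tauFun, hη, one_mul, hσ]

lemma tau_eq_tau_one (hη : η ^ (q + 1) = 1) (P : Pt F) : tau q F η P = tau q F 1 P := by
  simp only [tau, tauFun, hη, one_pow]

lemma tauFun_ne_zero (hσ : ∀ x, σ x = x ^ q) (hη : η ^ (q + 1) = 1) {X : Fin 4 → F}
    (hX : X ≠ 0) : tauFun q F η X ≠ 0 := by
  rw [tauFun_eq hσ hη]
  intro h
  refine hX (funext fun i => ?_)
  have h0 := congrFun h 0
  have h1 := congrFun h 1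
  have h2 := congrFun h 2
  have h3 := congrFun h 3
  simp only [Matrix.cons_val, Pi.zero_apply, map_eq_zero] at h0 h1 h2 h3
  fin_cases i <;> assumption

lemma baerMap_mem_span_iff (h : IsQuadConj σ) (hη : η * σ η = 1) {X : Fin 4 → F} {w : F × F} :
    w ∈ conjLine σ η X ↔
      baerMap σ η w ∈ Submodule.span F {X, ![σ (X 2), σ (X 3), σ (X 0), σ (X 1)]} := by
  rw [mem_conjLine, Submodule.mem_span_pair]
  constructor
  · rintro ⟨l, rfl⟩
    refine ⟨l, η * σ l, ?_⟩
    ext i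
    fin_cases i <;> simp [baerMap_apply, h.involutive]
    · ring
    · ring
    · linear_combination -(l * X 2) * hη
    · linear_combination -(l * X 3) * hη
  · rintro ⟨a, b, hab⟩
    obtain ⟨c, hc⟩ := h.exists_trace_one
    have key : ∀ {r s t : F}, a * r + b * σ s = t → a * s + b * σ r = η * σ t →
        t = (c * a + σ c * η * σ b) * r + η * σ ((c * a + σ c * η * σ b) * s) := by
      intro r s t h1 h2
      have h3 := congrArg σ h2
      simp only [map_add, map_mul, h.involutive] at h3 ⊢
      linear_combination (-c) * h1 - η * σ c * h3 - t * hc + (-(b * c * σ s) - t * σ c) * hη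
    have h0 := congrFun hab 0
    have h1 := congrFun hab 1
    have h2 := congrFun hab 2
    have h3 := congrFun hab 3
    simp only [baerMap_apply, Pi.smul_apply, Pi.add_apply, smul_eq_mul, Matrix.cons_val]
      at h0 h1 h2 h3
    exact ⟨_, Prod.ext (key h0 h2) (key h1 h3)⟩

lemma lineThrough_tau_inter (h : IsQuadConj σ) (hσ : ∀ x, σ x = x ^ q) (hη : η ^ (q + 1) = 1)
    (P : Pt F) :
    lineThrough F P (tau q F η P) ∩ SigmaSet q F η = pts σ η (conjLine σ η P.rep) := by
  refine inter_SigmaSet hσ fun w => ?_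
  rw [baerMap_mem_span_iff h (mul_conj_eq_one hσ hη), ← tauFun_eq hσ hη,
    tau, dif_pos (tauFun_ne_zero hσ hη P.rep_nonzero), Projectivization.submodule_mk,
    Projectivization.submodule_eq, Submodule.span_insert]

lemma Dspread_eq (h : IsQuadConj σ) (hσ : ∀ x, σ x = x ^ q) (hη : η ^ (q + 1) = 1) :
    Dspread q F η = pts σ η '' desSpread σ := by
  have key : ∀ P : Pt F, P.rep 2 = 0 → P.rep 3 = 0 →
      conjLine σ η P.rep = fieldLine σ (P.rep 0, P.rep 1) := by
    intro P h2 h3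
    ext w
    simp [mem_conjLine, mem_fieldLine, h2, h3]
  have hD : ∀ P : Pt F, rLine q F P ∩ SigmaSet q F η = pts σ η (conjLine σ η P.rep) := by
    intro P
    rw [rLine, ← tau_eq_tau_one hη, lineThrough_tau_inter h hσ hη]
  ext m
  constructor
  · rintro ⟨P, ⟨h2, h3⟩, rfl⟩
    rw [hD, key P h2 h3]
    refine ⟨_, ⟨_, fun h0 => P.rep_nonzero ?_, rfl⟩, rfl⟩
    ext i
    fin_cases i
    · exact congrArg Prod.fst h0
    · exact congrArg Prod.snd h0
    · exact h2
    · exact h3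
  · rintro ⟨_, ⟨w, hw, rfl⟩, rfl⟩
    have hX : ![w.1, w.2, 0, 0] ≠ 0 := fun h0 => hw (Prod.ext (congrFun h0 0) (congrFun h0 1))
    obtain ⟨c, hc⟩ := Projectivization.exists_smul_eq_mk_rep F _ hX
    have hc' := fun i => congrFun hc.symm i
    have h2 := hc' 2
    have h3 := hc' 3
    simp at h2 h3
    refine ⟨Projectivization.mk F _ hX, ⟨h2, h3⟩, ?_⟩
    rw [hD, key _ h2 h3, hc' 0, hc' 1]
    exact congrArg _ (fieldLine_smul c.ne_zero w).symm

variable (σ α) in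
/-- The line joining the points `(x₀, 0)` and `(x, y₀)` of `Σ_α`. -/
def pencilLine (x₀ y₀ x : F) : Set (Pt F) :=
  {P | P.submodule ≤ Submodule.span F {baerMap σ α (x₀, 0), baerMap σ α (x, y₀)}}

lemma mem_pencilLine {x₀ y₀ x : F} {P : Pt F} : P ∈ pencilLine σ α x₀ y₀ x ↔
    ∃ s t : F, P.rep = s • baerMap σ α (x₀, 0) + t • baerMap σ α (x, y₀) := by
  simp only [pencilLine, Set.mem_ofPred_eq, submodule_le_iff_rep_mem, Submodule.mem_span_pair,
    eq_comm]

lemma conjLine_combination (h : IsQuadConj σ) (x₀ y₀ x s t : F) :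
    conjLine σ η (s • baerMap σ α (x₀, 0) + t • baerMap σ α (x, y₀)) =
      ((fieldLine σ (s, t)).map (twistPair σ (η * σ α))).map (shear σ x₀ x y₀) := by
  ext w
  rw [mem_conjLine, Submodule.mem_map]
  simp only [mem_map_twistPair_fieldLine]
  constructor
  · rintro ⟨l, rfl⟩
    refine ⟨_, ⟨l, rfl⟩, Prod.ext ?_ ?_⟩ <;>
      simp [baerMap_apply, h.involutive] <;> ring
  · rintro ⟨_, ⟨l, rfl⟩, rfl⟩
    refine ⟨l, Prod.ext ?_ ?_⟩ <;>
      simp [baerMap_apply, h.involutive] <;> ring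

lemma Sspread_pencilLine (h : IsQuadConj σ) (hσ : ∀ x, σ x = x ^ q) (hη : η ^ (q + 1) = 1)
    {x₀ y₀ : F} (hx₀ : x₀ ≠ 0) (hy₀ : y₀ ≠ 0) (x : F) :
    Sspread q F η (pencilLine σ α x₀ y₀ x) =
      pts σ η '' (Submodule.map (shear σ x₀ x y₀) '' twistSpread σ (η * σ α)) := by
  ext m
  constructor
  · rintro ⟨Q, hQ, rfl⟩
    obtain ⟨s, t, hst⟩ := mem_pencilLine.1 hQ
    rw [lineThrough_tau_inter h hσ hη, hst, conjLine_combination h]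
    refine ⟨_, ⟨_, ⟨_, ⟨(s, t), fun h0 => Q.rep_nonzero ?_, rfl⟩, rfl⟩, rfl⟩, rfl⟩
    rw [hst, (Prod.mk_eq_zero.1 h0).1, (Prod.mk_eq_zero.1 h0).2, zero_smul, zero_smul, add_zero]
  · rintro ⟨_, ⟨_, ⟨_, ⟨⟨s, t⟩, hst, rfl⟩, rfl⟩, rfl⟩, rfl⟩
    have hX : s • baerMap σ α (x₀, 0) + t • baerMap σ α (x, y₀) ≠ 0 := by
      intro h0
      have h1 := congrFun h0 1
      have h2 := congrFun h0 0
      simp only [baerMap_apply, Pi.smul_apply, Pi.add_apply, smul_eq_mul, Matrix.cons_val,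
        Pi.zero_apply, mul_zero, zero_add, mul_eq_zero, hy₀, or_false] at h1 h2
      simp only [h1, zero_mul, add_zero, mul_eq_zero, hx₀, or_false] at h2
      exact hst (by rw [h1, h2]; rfl)
    obtain ⟨c, hc⟩ := Projectivization.exists_smul_eq_mk_rep F _ hX
    have hc' : (Projectivization.mk F _ hX).rep =
        ((c : F) * s) • baerMap σ α (x₀, 0) + ((c : F) * t) • baerMap σ α (x, y₀) := by
      rw [← hc, Units.smul_def, smul_add, smul_smul, smul_smul]
    refine ⟨Projectivization.mk F _ hX, mem_pencilLine.2 ⟨_, _, hc'⟩, ?_⟩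
    rw [lineThrough_tau_inter h hσ hη, hc', conjLine_combination h]
    exact congrArg (fun M => pts σ η ((M.map (twistPair σ (η * σ α))).map (shear σ x₀ x y₀)))
      (fieldLine_smul c.ne_zero (s, t)).symm

lemma switched_pencilLine [Finite F] (h : IsQuadConj σ) (hσ : ∀ x, σ x = x ^ q)
    (hq : 1 ≤ q) (hcard : Nat.card (fixedField σ) = q) (hη : η ^ (q + 1) = 1)
    {x₀ y₀ : F} (hx₀ : x₀ ≠ 0) (hy₀ : y₀ ≠ 0) (x : F) {ℓ : Set (Pt F)}
    (hℓ : ℓ = pencilLine σ α x₀ y₀ x) :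
    (Sspread q F η ℓ \ Rreg q F η ℓ) ∪ Ropp q F η ℓ =
      pts σ η '' (Submodule.map (shear σ x₀ x y₀) '' switchedSpread σ (η * σ α)) := by
  have hη0 : η ≠ 0 := by rintro rfl; simp at hη
  have hinj : Function.Injective fun M => pts σ η (Submodule.map (shear σ x₀ x y₀) M) :=
    (pts_injective hη0).comp (map_shear_injective hx₀ hy₀ x)
  have hS := Sspread_pencilLine h hσ hη (α := α) hx₀ hy₀ x
  have hD := Dspread_eq h hσ hη
  rw [← image_map_shear_desSpread hx₀ hy₀ x, Set.image_image] at hD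
  rw [Set.image_image] at hS ⊢
  have hR : Rreg q F η ℓ = (fun M => pts σ η (Submodule.map (shear σ x₀ x y₀) M)) ''
      (desSpread σ ∩ twistSpread σ (η * σ α)) := by
    rw [Rreg, hℓ, hS, hD, Set.image_inter hinj]
  rw [switchedSpread, Set.image_union, Set.image_sdiff hinj, ← hR, ← hS, ← hℓ]
  congr 1
  ext m
  simp only [Ropp, Set.mem_ofPred_eq, isLineOfSigma_iff h hσ hq hη0 hcard, hR, Set.forall_mem_image]
  have hbij := shear_bijective (σ := σ) hx₀ hy₀ x
  have hmeet : ∀ M N : Submodule (fixedField σ) (F × F),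
      (pts σ η (M.map (shear σ x₀ x y₀)) ∩ pts σ η (N.map (shear σ x₀ x y₀))).Nonempty ↔
        ∃ w ≠ 0, w ∈ M ∧ w ∈ N := by
    intro M N
    rw [pts_inter_nonempty_iff hη0]
    constructor
    · rintro ⟨_, h0, ⟨v, hv, rfl⟩, w, hw, he⟩
      obtain rfl := hbij.1 he
      exact ⟨w, fun h1 => h0 (by rw [h1, map_zero]), hv, hw⟩
    · rintro ⟨w, h0, hM, hN⟩
      exact ⟨_, (map_ne_zero_iff _ hbij.1).2 h0, Submodule.mem_map_of_mem hM,
        Submodule.mem_map_of_mem hN⟩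
  constructor
  · rintro ⟨⟨M, hM, rfl⟩, hmM⟩
    have he : M = (M.comap (shear σ x₀ x y₀)).map (shear σ x₀ x y₀) :=
      (Submodule.map_comap_eq_of_surjective hbij.2 M).symm
    refine ⟨M.comap (shear σ x₀ x y₀), ⟨?_, fun N hN => ?_⟩, congrArg _ he.symm⟩
    · rw [← hM, he, finrank_map_of_injective hbij.1, ← he]
    · rw [← hmeet, ← he]
      exact hmM hN
  · rintro ⟨M, ⟨hM, hmM⟩, rfl⟩
    exact ⟨⟨_, by rw [finrank_map_of_injective hbij.1, hM], rfl⟩,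
      fun N hN => (hmeet M N).2 (hmM N hN)⟩

end Incidence

section Pencil

variable {F : Type} [Field F] {σ : F →+* F} {q : ℕ} {α u v x₀ y₀ : F}

lemma Ppt_submodule (hx₀ : x₀ ≠ 0) (hu : σ x₀ = u * x₀) :
    (Ppt F α u).submodule = Submodule.span F {baerMap σ α (x₀, 0)} := by
  have : baerMap σ α (x₀, 0) = x₀ • ![1, 0, α * u, 0] := by
    ext i
    fin_cases i <;> simp [baerMap_apply, hu]
    ring
  rw [this, Submodule.span_singleton_smul_eq (IsUnit.mk0 _ hx₀), Ppt,
    Projectivization.submodule_mk]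

lemma rep_mk_three {w : F × F} (hw : baerMap σ α w ≠ 0) :
    (Projectivization.mk F _ hw).rep 3 = α * v * (Projectivization.mk F _ hw).rep 1 ↔
      α * σ w.2 = α * v * w.2 := by
  obtain ⟨c, hc⟩ := Projectivization.exists_smul_eq_mk_rep F _ hw
  rw [← hc]
  simp only [baerMap_apply, Units.smul_def, Pi.smul_apply, smul_eq_mul, Matrix.cons_val]
  rw [show α * v * ((c : F) * w.2) = c * (α * v * w.2) by ring, mul_right_inj' c.ne_zero]

lemma linearIndependent_pencil (hx₀ : x₀ ≠ 0) (hy₀ : y₀ ≠ 0) (x : F) :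
    LinearIndependent (fixedField σ) ![((x₀, 0) : F × F), (x, y₀)] := by
  rw [LinearIndependent.pair_iff' fun h => hx₀ (congrArg Prod.fst h)]
  intro c hc
  have := congrArg Prod.snd hc
  simp only [Prod.smul_snd, smul_zero] at this
  exact hy₀ this.symm

lemma pencilLine_congr (hx₀ : x₀ ≠ 0) {x x' : F}
    (hx : σ ((x - x') / x₀) = (x - x') / x₀) :
    pencilLine σ α x₀ y₀ x = pencilLine σ α x₀ y₀ x' := by
  have hc : ((x - x') / x₀) * x₀ = x - x' := div_mul_cancel₀ _ hx₀
  have he : baerMap σ α (x, y₀) =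
      ((x - x') / x₀) • baerMap σ α (x₀, 0) + baerMap σ α (x', y₀) := by
    have : ((x, y₀) : F × F) = (⟨(x - x') / x₀, hx⟩ : fixedField σ) • (x₀, 0) + (x', y₀) := by
      ext
      · simp [Subfield.smul_def, hc]
      · simp
    rw [this, map_add, map_smul]
    rfl
  rw [pencilLine, pencilLine, he, Submodule.span_insert, Submodule.span_insert]
  congr! 3
  refine le_antisymm (sup_le le_sup_left ?_) (sup_le le_sup_left ?_)
  · rw [Submodule.span_singleton_le_iff_mem]
    exact Submodule.add_mem_sup (Submodule.smul_mem _ _ (Submodule.mem_span_singleton_self _))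
      (Submodule.mem_span_singleton_self _)
  · rw [Submodule.span_singleton_le_iff_mem]
    refine Submodule.mem_sup.2 ⟨-((x - x') / x₀) • baerMap σ α (x₀, 0),
      Submodule.smul_mem _ _ (Submodule.mem_span_singleton_self _), _,
      Submodule.mem_span_singleton_self _, ?_⟩
    rw [← add_assoc, ← add_smul, neg_add_cancel, zero_smul, zero_add]

lemma rU1_eq {W : Submodule F (Fin 4 → F)} (hW : Module.finrank F W = 2)
    (h0 : ∀ X ∈ W, X 1 = 0 ∧ X 3 = 0) : {P : Pt F | P.submodule ≤ W} = rU1 F := by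
  have hi : LinearIndependent F ![(![1, 0, 0, 0] : Fin 4 → F), ![0, 0, 1, 0]] := by
    rw [LinearIndependent.pair_iff]
    intro s t hst
    have e0 := congrFun hst 0
    have e2 := congrFun hst 2
    simp at e0 e2
    exact ⟨e0, e2⟩
  have hmem : ∀ X : Fin 4 → F, X 1 = 0 → X 3 = 0 →
      X ∈ Submodule.span F {(![1, 0, 0, 0] : Fin 4 → F), ![0, 0, 1, 0]} := by
    intro X h1 h3
    refine Submodule.mem_span_pair.2 ⟨X 0, X 2, ?_⟩
    ext i
    fin_cases i <;> simp [h1, h3]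
  have he := eq_of_le_of_finrank_eq_two (fun X hX => hmem X (h0 X hX).1 (h0 X hX).2) hW
    (finrank_span_pair hi)
  ext P
  rw [Set.mem_ofPred_eq, submodule_le_iff_rep_mem, rU1, Set.mem_ofPred_eq]
  exact ⟨h0 _, fun hP => by rw [he]; exact hmem _ hP.1 hP.2⟩

lemma mem_pencil_diff_iff [Finite F] (h : IsQuadConj σ) (hσ : ∀ x, σ x = x ^ q) (hq : 1 ≤ q)
    (hcard : Nat.card (fixedField σ) = q) (hα : α ≠ 0) (hx₀ : x₀ ≠ 0) (hy₀ : y₀ ≠ 0)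
    (hu : σ x₀ = u * x₀) (hv : σ y₀ = v * y₀) {ℓ : Set (Pt F)} :
    ℓ ∈ pencil q F α u v \ {rU1 F} ↔ ∃ x, ℓ = pencilLine σ α x₀ y₀ x := by
  constructor
  · rintro ⟨⟨⟨W, hW, rfl⟩, hP, hplane, hm⟩, hne⟩
    have hAW : baerMap σ α (x₀, 0) ∈ W := by
      rw [Set.mem_ofPred_eq, Ppt_submodule hx₀ hu, Submodule.span_singleton_le_iff_mem] at hP
      exact hP
    have hA : baerMap σ α (x₀, 0) ≠ 0 := baerMap_ne_zero.2 fun h0 => hx₀ (congrArg Prod.fst h0)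
    obtain ⟨Q, hQ, hQA⟩ := Set.exists_ne_of_one_lt_ncard (by rw [hm]; omega)
      (Projectivization.mk F _ hA)
    obtain ⟨w, hw, rfl⟩ := (mem_SigmaSet hσ).1 hQ.2
    have hind := linearIndependent_baerMap hα (linearIndependent_of_mk_ne hA hw hQA.symm)
    have hwW : baerMap σ α w ∈ W := by
      have := hQ.1
      rwa [Set.mem_ofPred_eq, Projectivization.submodule_mk,
        Submodule.span_singleton_le_iff_mem] at this
    have hspan : ∀ {z}, baerMap σ α z ∈ W →
        LinearIndependent F ![baerMap σ α (x₀, 0), baerMap σ α z] →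
        Submodule.span F {baerMap σ α (x₀, 0), baerMap σ α z} = W := fun hz hi =>
      eq_of_le_of_finrank_eq_two (Submodule.span_le.2 (Set.pair_subset hAW hz))
        (finrank_span_pair hi) hW
    have hw2 : σ w.2 = v * w.2 := by
      have := (rep_mk_three hw).1 (hplane hQ.1)
      exact mul_left_cancel₀ hα (by rw [this, mul_assoc])
    have hw0 : w.2 ≠ 0 := by
      intro hw0
      refine hne (Set.mem_singleton_iff.2 (rU1_eq hW fun X hX => ?_))
      rw [← hspan hwW hind] at hX
      obtain ⟨a, b, rfl⟩ := Submodule.mem_span_pair.1 hX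
      simp [baerMap_apply, hw0]
    have hc : σ (y₀ / w.2) = y₀ / w.2 := by
      have hv0 : v ≠ 0 := by
        rintro rfl
        rw [zero_mul, map_eq_zero] at hv
        exact hy₀ hv
      rw [map_div₀, hv, hw2, mul_div_mul_left _ _ hv0]
    have hz : ((y₀ / w.2 * w.1, y₀) : F × F) = (⟨y₀ / w.2, hc⟩ : fixedField σ) • w := by
      ext
      · simp [Subfield.smul_def]
      · simp [Subfield.smul_def, hw0]
    refine ⟨y₀ / w.2 * w.1, ?_⟩
    rw [pencilLine, hspan ?_ (linearIndependent_baerMap hα (linearIndependent_pencil hx₀ hy₀ _))]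
    rw [hz, map_smul]
    exact W.smul_mem (y₀ / w.2) hwW
  · rintro ⟨x, rfl⟩
    have hi := linearIndependent_pencil (σ := σ) hx₀ hy₀ x
    have hi' := linearIndependent_baerMap hα hi
    refine ⟨⟨⟨_, finrank_span_pair hi', rfl⟩, ?_, ?_, ?_⟩, ?_⟩
    · rw [pencilLine, Set.mem_ofPred_eq, Ppt_submodule hx₀ hu]
      exact Submodule.span_mono (by simp)
    · intro P hP
      obtain ⟨s, t, hst⟩ := mem_pencilLine.1 hP
      rw [planeSet, Set.mem_ofPred_eq, hst]
      simp [baerMap_apply, hv]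
      ring
    · rw [pencilLine, inter_SigmaSet hσ (mem_iff_baerMap_mem h hα (finrank_span_pair hi')
        (finrank_span_pair hi) ?_), ncard_pts hα hcard (finrank_span_pair hi)]
      intro z hz
      obtain ⟨a, b, rfl⟩ := Submodule.mem_span_pair.1 hz
      rw [map_add, map_smul, map_smul]
      exact Submodule.mem_span_pair.2 ⟨(a : F), (b : F), rfl⟩
    · intro he
      have hB : baerMap σ α (x, y₀) ≠ 0 := baerMap_ne_zero.2 fun h0 => hy₀ (congrArg Prod.snd h0)
      have hmem : Projectivization.mk F _ hB ∈ pencilLine σ α x₀ y₀ x := by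
        rw [pencilLine, Set.mem_ofPred_eq, Projectivization.submodule_mk]
        exact Submodule.span_mono (by simp)
      rw [Set.mem_singleton_iff.1 he] at hmem
      obtain ⟨c, hc⟩ := Projectivization.exists_smul_eq_mk_rep F _ hB
      have h1 := hmem.1
      rw [← hc] at h1
      simp [baerMap_apply, Units.smul_def, hy₀] at h1

end Pencil

section FiniteField

lemma ncard_pow_eq_one {F : Type} [Field F] [Fintype F] {d : ℕ} (hd0 : d ≠ 0)
    (hd : d ∣ Fintype.card F - 1) : {x : F | x ^ d = 1}.ncard = d := by
  have hker := IsCyclic.card_powMonoidHom_ker Fˣ d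
  rw [Nat.card_units, Nat.card_eq_fintype_card (α := F), Nat.gcd_eq_right hd] at hker
  have : {x : F | x ^ d = 1} =
      Set.range fun x : (powMonoidHom d : Fˣ →* Fˣ).ker => ((x : Fˣ) : F) := by
    ext x
    constructor
    · intro hx
      refine ⟨⟨Units.ofPowEqOne x d hx hd0, ?_⟩, rfl⟩
      rw [MonoidHom.mem_ker]
      exact Units.ext hx
    · rintro ⟨y, rfl⟩
      exact congrArg Units.val (MonoidHom.mem_ker.1 y.2)
  rw [this, ← Nat.card_coe_set_eq, Nat.card_range_of_injective, hker]
  exact Units.val_injective.comp Subtype.val_injective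

lemma exists_isQuadConj {F : Type} [Field F] [Fintype F] {q : ℕ} (hq : IsPrimePow q)
    (hF : Fintype.card F = q ^ 2) :
    ∃ σ : F →+* F, (∀ x, σ x = x ^ q) ∧ IsQuadConj σ ∧ Nat.card (fixedField σ) = q := by
  have hq1 := hq.one_lt
  have hsub : q ^ 2 - 1 = (q + 1) * (q - 1) := by simpa using Nat.sq_sub_sq q 1
  obtain ⟨p, n, hp, -, rfl⟩ := hq
  have : Fact p.Prime := ⟨hp.nat_prime⟩
  have : CharP F p := charP_of_card_eq_prime_pow (f := n * 2) (by rw [hF, pow_mul])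
  set q := p ^ n
  let σ : F →+* F := iterateFrobenius F p n
  have hσ : ∀ x, σ x = x ^ q := fun x => iterateFrobenius_def ..
  have hcard : Nat.card (fixedField σ) = q := by
    have h1 : ((fixedField σ : Set F)) = insert 0 {x : F | x ^ (q - 1) = 1} := by
      ext x
      rw [SetLike.mem_coe, mem_fixedField, hσ, Set.mem_insert_iff, Set.mem_ofPred_eq]
      by_cases hx : x = 0
      · simp [hx, show q ≠ 0 by omega]
      · rw [← Nat.sub_add_cancel hq1.le, pow_succ, Nat.add_sub_cancel]
        simp [hx]
    have h2 : (0 : F) ∉ {x : F | x ^ (q - 1) = 1} := by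
      simp [show q - 1 ≠ 0 by omega]
    change Nat.card ((fixedField σ : Set F)) = q
    rw [Nat.card_coe_set_eq, h1, Set.ncard_insert_of_notMem h2,
      ncard_pow_eq_one (by omega) (by rw [hF, hsub]; exact Nat.dvd_mul_left _ _)]
    omega
  refine ⟨σ, hσ, ⟨fun x => ?_, ?_, ?_⟩, hcard⟩
  · rw [hσ, hσ, ← pow_mul, ← sq, ← hF, FiniteField.pow_card]
  · by_contra! hall
    have : fixedField σ = ⊤ := by ext x; simp [hall]
    rw [this, Nat.card_congr Subfield.topEquiv.toEquiv, Nat.card_eq_fintype_card, hF] at hcard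
    nlinarith
  · have := Module.card_eq_pow_finrank (K := fixedField σ) (V := F)
    rw [hF, ← Nat.card_eq_fintype_card, hcard] at this
    exact (Nat.pow_right_injective hq1 this).symm

end FiniteField

section Parallelism

variable {F : Type} [Field F] {σ : F →+* F} {q : ℕ} {η α u v : F}

lemma mem_Uset_iff (hσ : ∀ x, σ x = x ^ q) : u ∈ Uset q F ↔ u * σ u = 1 := by
  rw [hσ, ← pow_succ', Uset, Set.mem_ofPred_eq]

variable (q η) in
/-- The switched spreads arising from the pencil of `(α, u, v)`. -/
def switchedSpreads (t : F × F × F) : Set (Set (Set (Pt F))) :=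
  {S | ∃ ℓ ∈ pencil q F t.1 t.2.1 t.2.2 \ {rU1 F},
    S = (Sspread q F η ℓ \ Rreg q F η ℓ) ∪ Ropp q F η ℓ}

lemma mem_ParP {G : Finset (F × F × F)} {S : Set (Set (Pt F))} :
    S ∈ ParP q F η G ↔ (∃ t ∈ G, S ∈ switchedSpreads q η t) ∨ S = Dspread q F η := by
  simp only [ParP, Lset, switchedSpreads, Set.mem_union, Set.mem_singleton_iff, Set.mem_ofPred_eq,
    Set.mem_iUnion]
  refine or_congr_left ⟨?_, ?_⟩
  · rintro ⟨ℓ, ⟨t, ht, hℓ⟩, rfl⟩; exact ⟨t, ht, ℓ, hℓ, rfl⟩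
  · rintro ⟨t, ht, ℓ, hℓ, rfl⟩; exact ⟨ℓ, ⟨t, ht, hℓ⟩, rfl⟩

/-- Hypotheses on a triple `(α, u, v)` under which its switched spreads are well behaved. -/
structure IsAdmissible (σ : F →+* F) (t : F × F × F) : Prop where
  ne_zero : t.1 ≠ 0
  norm_ne_one : t.1 * σ t.1 ≠ 1
  norm_fst : t.2.1 * σ t.2.1 = 1
  norm_snd : t.2.2 * σ t.2.2 = 1

/-- The standing hypotheses on `σ` and `η`. -/
structure IsSetting (σ : F →+* F) (q : ℕ) (η : F) : Prop where
  isQuadConj : IsQuadConj σ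
  apply_eq : ∀ x, σ x = x ^ q
  card_fixedField : Nat.card (fixedField σ) = q
  one_le : 1 ≤ q
  pow_eq_one : η ^ (q + 1) = 1

variable {t : F × F × F}

lemma IsSetting.ne_zero (hs : IsSetting σ q η) : η ≠ 0 := by
  rintro rfl
  simpa using hs.pow_eq_one

lemma IsSetting.mul_conj (hs : IsSetting σ q η) : η * σ η = 1 :=
  mul_conj_eq_one hs.apply_eq hs.pow_eq_one

lemma twist_param_norm_ne_one (hs : IsSetting σ q η) (ht : IsAdmissible σ t) :
    η * σ t.1 * σ (η * σ t.1) ≠ 1 := by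
  intro he
  refine ht.norm_ne_one ?_
  rw [map_mul, hs.isQuadConj.involutive] at he
  linear_combination he - t.1 * σ t.1 * hs.mul_conj

lemma twist_param_ne_zero (hs : IsSetting σ q η) (ht : IsAdmissible σ t) : η * σ t.1 ≠ 0 :=
  mul_ne_zero hs.ne_zero ((map_ne_zero σ).2 ht.ne_zero)

lemma exists_switchedSpreads_param [Finite F] (hs : IsSetting σ q η) (ht : IsAdmissible σ t) :
    ∃ x₀ y₀ : F, x₀ ≠ 0 ∧ y₀ ≠ 0 ∧ σ x₀ = t.2.1 * x₀ ∧ σ y₀ = t.2.2 * y₀ ∧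
      ∃ Φ : F → Set (Set (Pt F)),
        (∀ x, Φ x = pts σ η '' (Submodule.map (shear σ x₀ x y₀) '' switchedSpread σ (η * σ t.1))) ∧
        (∀ S, S ∈ switchedSpreads q η t ↔ ∃ x, S = Φ x) ∧
        ∀ x x', σ ((x - x') / x₀) = (x - x') / x₀ → Φ x = Φ x' := by
  obtain ⟨x₀, hx₀, hu⟩ := hs.isQuadConj.exists_eq_mul ht.norm_fst
  obtain ⟨y₀, hy₀, hv⟩ := hs.isQuadConj.exists_eq_mul ht.norm_snd
  have hsw := fun x => switched_pencilLine hs.isQuadConj hs.apply_eq hs.one_le hs.card_fixedField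
    hs.pow_eq_one (α := t.1) hx₀ hy₀ x rfl
  refine ⟨x₀, y₀, hx₀, hy₀, hu, hv, _, fun x => rfl, fun S => ?_, fun x x' hx => ?_⟩
  · simp only [switchedSpreads, Set.mem_ofPred_eq, mem_pencil_diff_iff hs.isQuadConj hs.apply_eq
      hs.one_le hs.card_fixedField ht.ne_zero hx₀ hy₀ hu hv, ← hsw]
    constructor
    · rintro ⟨_, ⟨x, rfl⟩, rfl⟩; exact ⟨x, rfl⟩
    · rintro ⟨x, rfl⟩; exact ⟨_, ⟨x, rfl⟩, rfl⟩
  · rw [← hsw, ← hsw, pencilLine_congr hx₀ hx]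

lemma isSpread_of_mem_switchedSpreads [Finite F] (hs : IsSetting σ q η) (ht : IsAdmissible σ t)
    {S : Set (Set (Pt F))} (hS : S ∈ switchedSpreads q η t) : IsSpreadOfSigma q F η S := by
  obtain ⟨x₀, y₀, hx₀, hy₀, -, -, Φ, hΦ, hmem, -⟩ := exists_switchedSpreads_param hs ht
  obtain ⟨x, rfl⟩ := (hmem S).1 hS
  rw [hΦ]
  exact isSpreadOfSigma_image hs.isQuadConj hs.apply_eq hs.one_le hs.ne_zero hs.card_fixedField
    ((isVectorSpread_switchedSpread hs.isQuadConj (twist_param_norm_ne_one hs ht)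
      (twist_param_ne_zero hs ht)).map (shear_bijective hx₀ hy₀ x))

lemma notMem_desSpread_of_mem_switchedSpreads [Finite F] (hs : IsSetting σ q η)
    (ht : IsAdmissible σ t) {S : Set (Set (Pt F))} (hS : S ∈ switchedSpreads q η t)
    {M : Submodule (fixedField σ) (F × F)} (hM : pts σ η M ∈ S) : M ∉ desSpread σ := by
  obtain ⟨x₀, y₀, hx₀, hy₀, -, -, Φ, hΦ, hmem, -⟩ := exists_switchedSpreads_param hs ht
  obtain ⟨x, rfl⟩ := (hmem S).1 hS
  rw [hΦ, (pts_injective hs.ne_zero).mem_set_image] at hM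
  rw [← image_map_shear_desSpread hx₀ hy₀ x]
  refine Set.disjoint_left.1 (Set.disjoint_image_of_injective (map_shear_injective hx₀ hy₀ x) ?_) hM
  exact disjoint_switchedSpread_desSpread hs.isQuadConj (twist_param_norm_ne_one hs ht)
    (twist_param_ne_zero hs ht)

lemma eq_of_mem_switchedSpreads [Finite F] (hs : IsSetting σ q η) (ht : IsAdmissible σ t)
    {S S' : Set (Set (Pt F))} (hS : S ∈ switchedSpreads q η t) (hS' : S' ∈ switchedSpreads q η t)
    {M : Submodule (fixedField σ) (F × F)} (hM : Module.finrank (fixedField σ) M = 2)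
    (h : pts σ η M ∈ S) (h' : pts σ η M ∈ S') : S = S' := by
  have hdes := notMem_desSpread_of_mem_switchedSpreads hs ht hS h
  obtain ⟨x₀, y₀, hx₀, hy₀, -, -, Φ, hΦ, hmem, hcongr⟩ := exists_switchedSpreads_param hs ht
  obtain ⟨x, rfl⟩ := (hmem S).1 hS
  obtain ⟨x', rfl⟩ := (hmem S').1 hS'
  rw [hΦ, (pts_injective hs.ne_zero).mem_set_image] at h h'
  refine hcongr x x' ?_
  have hk := twist_param_norm_ne_one hs ht
  have hk0 := twist_param_ne_zero hs ht
  rcases hs.isQuadConj.classification hM with hD | ⟨a, b, hb, rfl⟩ | ⟨m, p, r, hm, hr, rfl⟩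
  · exact absurd hD hdes
  · exact graphLine_mem_image_unique hs.isQuadConj hk hk0 hx₀ hy₀ hb h h'
  · exact meetingLine_mem_image_unique hs.isQuadConj hk hk0 hx₀ hy₀ hm h h'

lemma exists_mem_switchedSpreads_graphLine_iff [Finite F] (hs : IsSetting σ q η)
    (ht : IsAdmissible σ t) {a b : F} (hb : b ≠ 0) :
    (∃ S ∈ switchedSpreads q η t, pts σ η (graphLine σ a b) ∈ S) ↔
      t.2.1 * t.2.2 * (t.1 / σ t.1) = -(σ b * η / (b * σ η)) := by
  obtain ⟨x₀, y₀, hx₀, hy₀, hu, hv, Φ, hΦ, hmem, -⟩ := exists_switchedSpreads_param hs ht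
  have hiff := exists_graphLine_mem_image_iff hs.isQuadConj (twist_param_norm_ne_one hs ht)
    (twist_param_ne_zero hs ht) hx₀ hy₀ hu hv (a := a) hb
  have hη : σ η ≠ 0 := (map_ne_zero σ).2 hs.ne_zero
  have hα : σ t.1 ≠ 0 := (map_ne_zero σ).2 ht.ne_zero
  rw [map_mul, hs.isQuadConj.involutive] at hiff
  have he : t.2.1 * t.2.2 * (t.1 / σ t.1) = -(σ b * η / (b * σ η)) ↔
      σ b * (η * σ t.1) = -(b * (t.2.1 * t.2.2 * (σ η * t.1))) := by
    field_simp
    constructor <;> intro e <;> linear_combination e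
  rw [he, ← hiff]
  simp only [hmem, ↓existsAndEq, true_and, hΦ,
    (pts_injective hs.ne_zero).mem_set_image]

lemma exists_mem_switchedSpreads_meetingLine_iff [Finite F] (hs : IsSetting σ q η)
    (ht : IsAdmissible σ t) {m p r : F} (hm : m ≠ 0) (hr : r ≠ 0) :
    (∃ S ∈ switchedSpreads q η t, pts σ η (meetingLine σ m p r) ∈ S) ↔
      t.2.2 / t.2.1 = σ r * m / (r * σ m) := by
  obtain ⟨x₀, y₀, hx₀, hy₀, hu, hv, Φ, hΦ, hmem, -⟩ := exists_switchedSpreads_param hs ht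
  have hiff := exists_meetingLine_mem_image_iff hs.isQuadConj (twist_param_norm_ne_one hs ht)
    (twist_param_ne_zero hs ht) hx₀ hy₀ hu hv (p := p) hm hr
  have hσm : σ m ≠ 0 := (map_ne_zero σ).2 hm
  have hu0 : t.2.1 ≠ 0 := left_ne_zero_of_mul_eq_one ht.norm_fst
  have he : t.2.2 / t.2.1 = σ r * m / (r * σ m) ↔ σ r * m * t.2.1 = r * σ m * t.2.2 := by
    field_simp
    constructor <;> intro e <;> linear_combination -e
  rw [he, ← hiff]
  simp only [hmem, ↓existsAndEq, true_and, hΦ, (pts_injective hs.ne_zero).mem_set_image]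

lemma notMem_Dspread (hs : IsSetting σ q η) {M : Submodule (fixedField σ) (F × F)}
    (hM : M ∉ desSpread σ) : pts σ η M ∉ Dspread q F η := by
  rwa [Dspread_eq hs.isQuadConj hs.apply_eq hs.pow_eq_one,
    (pts_injective hs.ne_zero).mem_set_image]

variable {G : Finset (F × F × F)} {c : F × F × F → F}

/-- If every value in `Uset` is forced by some line, then covering all lines makes `c` injective. -/
lemma injOn_of_isParallelism [Finite F] (hs : IsSetting σ q η) (hcard : G.card = q + 1)
    (hU : (Uset q F).ncard = q + 1) (hc : Set.MapsTo c G (Uset q F))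
    (hcov : ∀ w ∈ Uset q F, ∃ M : Submodule (fixedField σ) (F × F),
      Module.finrank (fixedField σ) M = 2 ∧ M ∉ desSpread σ ∧
        ∀ t ∈ G, (∃ S ∈ switchedSpreads q η t, pts σ η M ∈ S) → c t = w)
    (hP : IsParallelismOfSigma q F η (ParP q F η G)) : Set.InjOn c G := by
  have hfin := Set.toFinite (Uset q F)
  refine Finset.injOn_of_surjOn_of_card_le (t := hfin.toFinset) c (by simpa using hc) ?_
    (by rw [hcard, ← Set.ncard_eq_toFinset_card _ hfin, hU])
  intro w hw
  obtain ⟨M, hM, hD, hMt⟩ := hcov w (by simpa using hw)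
  obtain ⟨S, ⟨hS, hMS⟩, -⟩ := hP.2 (pts σ η M) ((isLineOfSigma_iff hs.isQuadConj hs.apply_eq
    hs.one_le hs.ne_zero hs.card_fixedField).2 ⟨M, hM, rfl⟩)
  rcases mem_ParP.1 hS with ⟨t, ht, hSt⟩ | rfl
  · exact ⟨t, ht, hMt t ht ⟨S, hSt, hMS⟩⟩
  · exact absurd hMS (notMem_Dspread hs hD)

/-- If `c` is injective, a line prescribing a value of `c` in `Uset` is covered exactly once. -/
lemma existsUnique_of_injOn [Finite F] (hs : IsSetting σ q η) (ht : ∀ t ∈ G, IsAdmissible σ t)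
    (hcard : G.card = q + 1) (hU : (Uset q F).ncard = q + 1) (hc : Set.MapsTo c G (Uset q F))
    (hinj : Set.InjOn c G) {M : Submodule (fixedField σ) (F × F)}
    (hM : Module.finrank (fixedField σ) M = 2) (hD : M ∉ desSpread σ) {w : F}
    (hw : w ∈ Uset q F)
    (hMt : ∀ t ∈ G, (∃ S ∈ switchedSpreads q η t, pts σ η M ∈ S) ↔ c t = w) :
    ∃! S, S ∈ ParP q F η G ∧ pts σ η M ∈ S := by
  have hfin := Set.toFinite (Uset q F)
  have hsurj := Finset.surjOn_of_injOn_of_card_le (t := hfin.toFinset) c (by simpa using hc) hinj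
    (by rw [hcard, ← Set.ncard_eq_toFinset_card _ hfin, hU])
  obtain ⟨t, htG, htw⟩ := hsurj (by simpa using hw)
  obtain ⟨S, hS, hMS⟩ := (hMt t htG).2 htw
  refine ⟨S, ⟨mem_ParP.2 (Or.inl ⟨t, htG, hS⟩), hMS⟩, ?_⟩
  rintro S' ⟨hS', hMS'⟩
  rcases mem_ParP.1 hS' with ⟨t', ht', hSt'⟩ | rfl
  · obtain rfl := hinj ht' htG (((hMt t' ht').1 ⟨S', hSt', hMS'⟩).trans htw.symm)
    exact eq_of_mem_switchedSpreads hs (ht t' ht') hSt' hS hM hMS' hMS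
  · exact absurd hMS' (notMem_Dspread hs hD)

lemma mul_mem_Uset {w z : F} (hw : w ∈ Uset q F) (hz : z ∈ Uset q F) : w * z ∈ Uset q F := by
  rw [Uset, Set.mem_ofPred_eq] at *
  rw [mul_pow, hw, hz, one_mul]

lemma div_mem_Uset {w z : F} (hw : w ∈ Uset q F) (hz : z ∈ Uset q F) : w / z ∈ Uset q F := by
  rw [Uset, Set.mem_ofPred_eq] at *
  rw [div_pow, hw, hz, div_one]

lemma div_conj_mem_Uset (hs : IsSetting σ q η) {w : F} (hw : w ≠ 0) : w / σ w ∈ Uset q F := by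
  have := (map_ne_zero σ).2 hw
  rw [mem_Uset_iff hs.apply_eq, map_div₀, hs.isQuadConj.involutive]
  field_simp

lemma neg_mem_Uset (hs : IsSetting σ q η) {w : F} (hw : w ∈ Uset q F) : -w ∈ Uset q F := by
  rw [mem_Uset_iff hs.apply_eq] at *
  rw [map_neg, neg_mul_neg, hw]

theorem isParallelism_iff_injOn [Finite F] (hs : IsSetting σ q η)
    (ht : ∀ t ∈ G, IsAdmissible σ t) (hcard : G.card = q + 1) (hU : (Uset q F).ncard = q + 1) :
    IsParallelismOfSigma q F η (ParP q F η G) ↔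
      Set.InjOn (fun t : F × F × F => t.2.2 / t.2.1) G ∧
        Set.InjOn (fun t : F × F × F => t.2.1 * t.2.2 * (t.1 / σ t.1)) G := by
  have hc₁ : Set.MapsTo (fun t : F × F × F => t.2.2 / t.2.1) G (Uset q F) := fun t hG =>
    div_mem_Uset ((mem_Uset_iff hs.apply_eq).2 (ht t hG).norm_snd)
      ((mem_Uset_iff hs.apply_eq).2 (ht t hG).norm_fst)
  have hc₂ : Set.MapsTo (fun t : F × F × F => t.2.1 * t.2.2 * (t.1 / σ t.1)) G (Uset q F) :=
    fun t hG => mul_mem_Uset (mul_mem_Uset ((mem_Uset_iff hs.apply_eq).2 (ht t hG).norm_fst)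
      ((mem_Uset_iff hs.apply_eq).2 (ht t hG).norm_snd)) (div_conj_mem_Uset hs (ht t hG).ne_zero)
  have hline : ∀ m, IsLineOfSigma q F η m ↔ _ := fun m =>
    isLineOfSigma_iff hs.isQuadConj hs.apply_eq hs.one_le hs.ne_zero hs.card_fixedField
  have hη : σ η ≠ 0 := (map_ne_zero σ).2 hs.ne_zero
  constructor
  · refine fun hP => ⟨injOn_of_isParallelism hs hcard hU hc₁ (fun w hw => ?_) hP,
      injOn_of_isParallelism hs hcard hU hc₂ (fun w hw => ?_) hP⟩
    · obtain ⟨r, hr, hrw⟩ := hs.isQuadConj.exists_eq_mul ((mem_Uset_iff hs.apply_eq).1 hw)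
      refine ⟨meetingLine σ 1 0 r, finrank_meetingLine one_ne_zero hr 0,
        meetingLine_notMem_desSpread one_ne_zero hr, fun t hG hcov => ?_⟩
      rw [exists_mem_switchedSpreads_meetingLine_iff hs (ht t hG) one_ne_zero hr, hrw] at hcov
      simpa [hr] using hcov
    · have hw' := neg_mem_Uset hs (div_mem_Uset hw (div_conj_mem_Uset hs hs.ne_zero))
      obtain ⟨b, hb, hbw⟩ := hs.isQuadConj.exists_eq_mul ((mem_Uset_iff hs.apply_eq).1 hw')
      refine ⟨graphLine σ 0 b, hs.isQuadConj.finrank_graphLine 0 b,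
        graphLine_notMem_desSpread hs.isQuadConj hb, fun t hG hcov => ?_⟩
      rw [exists_mem_switchedSpreads_graphLine_iff hs (ht t hG) hb, hbw] at hcov
      rw [hcov]
      have := hs.ne_zero
      field_simp
  · rintro ⟨h₁, h₂⟩
    refine ⟨fun S hS => ?_, fun l hl => ?_⟩
    · rcases mem_ParP.1 hS with ⟨t, hG, hSt⟩ | rfl
      · exact isSpread_of_mem_switchedSpreads hs (ht t hG) hSt
      · rw [Dspread_eq hs.isQuadConj hs.apply_eq hs.pow_eq_one]
        exact isSpreadOfSigma_image hs.isQuadConj hs.apply_eq hs.one_le hs.ne_zero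
          hs.card_fixedField hs.isQuadConj.isVectorSpread_desSpread
    · obtain ⟨M, hM, rfl⟩ := (hline l).1 hl
      rcases hs.isQuadConj.classification hM with hD | ⟨a, b, hb, rfl⟩ | ⟨m, p, r, hm, hr, rfl⟩
      · refine ⟨Dspread q F η, ⟨mem_ParP.2 (Or.inr rfl), ?_⟩, ?_⟩
        · rw [Dspread_eq hs.isQuadConj hs.apply_eq hs.pow_eq_one]
          exact ⟨M, hD, rfl⟩
        · rintro S ⟨hS, hMS⟩
          rcases mem_ParP.1 hS with ⟨t, hG, hSt⟩ | rfl
          · exact absurd hD (notMem_desSpread_of_mem_switchedSpreads hs (ht t hG) hSt hMS)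
          · rfl
      · refine existsUnique_of_injOn hs ht hcard hU hc₂ h₂ hM
          (graphLine_notMem_desSpread hs.isQuadConj hb) (w := -(σ b * η / (b * σ η)))
          (neg_mem_Uset hs ?_) fun t hG => exists_mem_switchedSpreads_graphLine_iff hs (ht t hG) hb
        rw [show σ b * η / (b * σ η) = η / σ η / (b / σ b) by
          have := (map_ne_zero σ).2 hb
          field_simp]
        exact div_mem_Uset (div_conj_mem_Uset hs hs.ne_zero) (div_conj_mem_Uset hs hb)
      · refine existsUnique_of_injOn hs ht hcard hU hc₁ h₁ hM
          (meetingLine_notMem_desSpread hm hr) (w := σ r * m / (r * σ m)) ?_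
          fun t hG => exists_mem_switchedSpreads_meetingLine_iff hs (ht t hG) hm hr
        rw [show σ r * m / (r * σ m) = m / σ m / (r / σ r) by
          have := (map_ne_zero σ).2 hr
          field_simp]
        exact div_mem_Uset (div_conj_mem_Uset hs hm) (div_conj_mem_Uset hs hr)

lemma isGoodSet_iff_injOn {I : Set F} (hs : IsSetting σ q η) (ht : ∀ t ∈ G, IsAdmissible σ t)
    (hcard : G.card = q + 1) (hmem : ∀ t ∈ G, t.1 ∈ I ∧ t.2.1 ∈ Uset q F ∧ t.2.2 ∈ Uset q F) :
    IsGoodSet q F I G ↔ Set.InjOn (fun t : F × F × F => t.2.2 / t.2.1) G ∧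
      Set.InjOn (fun t : F × F × F => t.2.1 * t.2.2 * (t.1 / σ t.1)) G := by
  have key : ∀ t ∈ G, ∀ t' ∈ G,
      (t.2.1 * t'.2.2 - t'.2.1 * t.2.2 = 0 ↔ t.2.2 / t.2.1 = t'.2.2 / t'.2.1) ∧
      (t.1 * t.2.1 * (t'.1 * t'.2.2) ^ q - (t.1 * t.2.2) ^ q * (t'.1 * t'.2.1) = 0 ↔
        t.2.1 * t.2.2 * (t.1 / σ t.1) = t'.2.1 * t'.2.2 * (t'.1 / σ t'.1)) := by
    intro t hG t' hG'
    have hu := left_ne_zero_of_mul_eq_one (ht t hG).norm_fst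
    have hu' := left_ne_zero_of_mul_eq_one (ht t' hG').norm_fst
    have hv := left_ne_zero_of_mul_eq_one (ht t hG).norm_snd
    have hv' := left_ne_zero_of_mul_eq_one (ht t' hG').norm_snd
    have hα := (map_ne_zero σ).2 (ht t hG).ne_zero
    have hα' := (map_ne_zero σ).2 (ht t' hG').ne_zero
    rw [← hs.apply_eq, ← hs.apply_eq, map_mul, map_mul,
      eq_inv_of_mul_eq_one_right (ht t hG).norm_snd, eq_inv_of_mul_eq_one_right (ht t' hG').norm_snd,
      sub_eq_zero, sub_eq_zero]
    constructor
    · rw [div_eq_div_iff hu hu']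
      constructor <;> intro e <;> linear_combination -e
    · field_simp
  simp only [IsGoodSet, hcard, true_and, Set.InjOn, Finset.mem_coe]
  rw [and_iff_right hmem]
  constructor
  · intro hG
    refine ⟨fun t htG t' htG' he => ?_, fun t htG t' htG' he => ?_⟩ <;> by_contra hne
    · exact (hG t htG t' htG' hne).1 ((key t htG t' htG').1.2 he)
    · exact (hG t htG t' htG' hne).2 ((key t htG t' htG').2.2 he)
  · rintro ⟨h₁, h₂⟩ t htG t' htG' hne
    exact ⟨fun he => hne (h₁ htG htG' ((key t htG t' htG').1.1 he)),
      fun he => hne (h₂ htG htG' ((key t htG t' htG').2.1 he))⟩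

end Parallelism

/-- Main theorem: `Π_G` is a parallelism of `Σ_η` iff `G` is a good set. -/
theorem statement9 (q : ℕ) (hq : IsPrimePow q) (hq3 : 3 ≤ q) (F : Type) [Field F] [Fintype F]
    (hF : Fintype.card F = q ^ 2) (I : Set F) (hI : IsIndexSet q F I)
    (η : F) (hηU : η ^ (q + 1) = 1)
    (G : Finset (F × F × F)) (hcard : G.card = q + 1)
    (hmem : ∀ t ∈ G, t.1 ∈ I ∧ t.2.1 ∈ Uset q F ∧ t.2.2 ∈ Uset q F) :
    IsParallelismOfSigma q F η (ParP q F η G) ↔ IsGoodSet q F I G := by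
  obtain ⟨σ, hσ, hconj, hfix⟩ := exists_isQuadConj hq hF
  have hs : IsSetting σ q η := ⟨hconj, hσ, hfix, by omega, hηU⟩
  have ht : ∀ t ∈ G, IsAdmissible σ t := by
    intro t hG
    obtain ⟨h1, h2, h3⟩ := hmem t hG
    refine ⟨fun h0 => hI.1 (h0 ▸ h1), fun h0 => hI.2.2.2.1 ⟨t.1, h1, ?_⟩,
      (mem_Uset_iff hσ).1 h2, (mem_Uset_iff hσ).1 h3⟩
    rw [← h0, hσ, ← pow_succ']
  have hU : (Uset q F).ncard = q + 1 := by
    refine ncard_pow_eq_one (by omega) ⟨q - 1, ?_⟩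
    rw [hF]
    simpa using Nat.sq_sub_sq q 1
  rw [isParallelism_iff_injOn hs ht hcard hU, isGoodSet_iff_injOn hs ht hcard hmem]
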